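/- arXiv:1901.00517 — 4 statements merged into one kernel-verified Lean document; each statement's English description precedes it below -/
import Mathlib

section
/- There exist families (X_α)_{α<ω₁}, (Y_α)_{α<ω₁}, (A_α)_{α<ω₁}, (B_α)_{α<ω₁} of subsets of ℕ such that: (1) for every α < ω₁, X_α = A_α ∪ B_α is infinite and A_α ∩ B_α = ∅; (2) X_β ∩ X_α is finite for all β < α < ω₁; (3) Y_β \ Y_α is finite for all β < α < ω₁; (4) X_β \ Y_α is finite for all β < α < ω₁; (5) X_α ∩ Y_α = ∅ for all α < ω₁; (6) for every α < ω₁ and every k ∈ ℕ, for all but finitely many β < α there is l > k such that l ∈ A_β ∩ B_α. -/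
open Set

/-- the first uncountable ordinal -/
noncomputable def omega1 : Ordinal := (Cardinal.aleph 1).ord

/-- Weighted Hall lemma. -/
lemma hall_levels {ι : Type*} (t : ι → Finset ℕ) (c d : ι → ℕ)
    (hdis : ∀ a b, a ≠ b → c a = c b → Disjoint (t a) (t b))
    (hcard : ∀ a, 3 * d a * 2 ^ (c a + 1) ≤ (t a).card) :
    ∃ r : ι → Fin 3 → Finset ℕ, (∀ a j, r a j ⊆ t a) ∧ (∀ a j, (r a j).card = d a) ∧
      (∀ a j b k, (a, j) ≠ (b, k) → Disjoint (r a j) (r b k)) := by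
  classical
  have key : ∃ f : (Σ a : ι, Fin 3 × Fin (d a)) → ℕ, Function.Injective f ∧ ∀ x, f x ∈ t x.1 := by
    refine (Finset.all_card_le_biUnion_card_iff_exists_injective
      (fun x : (Σ a : ι, Fin 3 × Fin (d a)) => t x.1)).1 ?_
    intro s
    set U := s.biUnion (fun x => t x.1) with hU
    set S := s.image Sigma.fst with hS
    have h1 : s.card ≤ ∑ a ∈ S, 3 * d a := by
      have hsub : s ⊆ S.sigma (fun a => (Finset.univ : Finset (Fin 3 × Fin (d a)))) := by
        intro x hx
        simp only [Finset.mem_sigma, Finset.mem_univ, and_true]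
        exact Finset.mem_image_of_mem _ hx
      refine (Finset.card_le_card hsub).trans ?_
      rw [Finset.card_sigma]
      simp
    have hinner : ∀ x : ℕ, ∑ a ∈ S with x ∈ t a, ((1:ℝ)/2) ^ (c a + 1) ≤ 1 := by
      intro x
      have hinj : Set.InjOn c ((S.filter (fun a => x ∈ t a) : Finset ι) : Set ι) := by
        intro a ha b hb hab
        by_contra hne
        have := hdis a b hne hab
        simp only [Finset.coe_filter, Set.mem_ofPred_eq] at ha hb
        exact Finset.disjoint_left.1 this ha.2 hb.2
      rw [← Finset.sum_image (f := fun n => ((1:ℝ)/2) ^ (n + 1)) hinj]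
      have hs : HasSum (fun n : ℕ => ((1:ℝ)/2) ^ (n+1)) 1 := by
        have := hasSum_geometric_two' 1
        convert this using 2 with n
        rw [pow_succ, one_div, inv_pow]; ring
      exact sum_le_hasSum _ (fun _ _ => by positivity) hs
    have h2 : (∑ a ∈ S, 3 * d a : ℝ) ≤ U.card := by
      calc (∑ a ∈ S, 3 * d a : ℝ) ≤ ∑ a ∈ S, ((t a).card : ℝ) * (1/2) ^ (c a + 1) := by
            refine Finset.sum_le_sum fun a _ => ?_
            have := hcard a
            have h' : (3 * d a * 2 ^ (c a + 1) : ℝ) ≤ (t a).card := by exact_mod_cast this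
            rw [one_div, inv_pow, ← div_eq_mul_inv, le_div_iff₀ (by positivity)]
            exact h'
        _ = ∑ a ∈ S, ∑ x ∈ U, if x ∈ t a then ((1:ℝ)/2) ^ (c a + 1) else 0 := by
            refine Finset.sum_congr rfl fun a ha => ?_
            rw [← Finset.sum_filter, Finset.sum_const, nsmul_eq_mul]
            congr 3
            ext x
            simp only [Finset.mem_filter]
            constructor
            · intro hx
              refine ⟨?_, hx⟩
              obtain ⟨y, hy, rfl⟩ := Finset.mem_image.1 ha
              exact Finset.mem_biUnion.2 ⟨y, hy, hx⟩
            · exact fun h => h.2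
        _ = ∑ x ∈ U, ∑ a ∈ S, if x ∈ t a then ((1:ℝ)/2) ^ (c a + 1) else 0 := Finset.sum_comm
        _ ≤ ∑ x ∈ U, 1 := by
            refine Finset.sum_le_sum fun x _ => ?_
            rw [← Finset.sum_filter]
            exact hinner x
        _ = U.card := by simp
    have h3 : (∑ a ∈ S, 3 * d a) ≤ U.card := by exact_mod_cast h2
    exact h1.trans h3
  obtain ⟨f, hf, hft⟩ := key
  refine ⟨fun a j => Finset.univ.image (fun k : Fin (d a) => f ⟨a, j, k⟩), ?_, ?_, ?_⟩
  · intro a j x hx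
    obtain ⟨k, -, rfl⟩ := Finset.mem_image.1 hx
    exact hft ⟨a, j, k⟩
  · intro a j
    rw [Finset.card_image_of_injective]
    · simp
    · intro k k' h
      have := hf h
      simpa using this
  · intro a j b k hne
    rw [Finset.disjoint_left]
    intro x hx hy
    obtain ⟨u, -, rfl⟩ := Finset.mem_image.1 hx
    obtain ⟨v, -, hv⟩ := Finset.mem_image.1 hy
    have := hf hv
    apply hne
    simp only [Sigma.mk.injEq] at this
    obtain ⟨rfl, h⟩ := this
    have h := eq_of_heq h
    simp only [Prod.mk.injEq] at h
    rw [h.1]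

lemma merge {ι : Type*} (m : ι → ℕ) (hm : Function.Injective m) (S : ι → Set ℕ) (V : ℕ → Set ℕ)
    (hV : Antitone V)
    (h : ∀ i, ∃ (p : ι → Finset ℕ) (Q : Set ι), (∀ a, (p a : Set ℕ) ⊆ S a ∩ V i) ∧
      (∀ a ∈ Q, (S a ∩ V i).Infinite) ∧ (∀ a b, a ≠ b → Disjoint (p a) (p b)) ∧
      ∀ k, {a | a ∉ Q ∧ (p a).card < k}.Finite) :
    ∃ r : ι → Fin 3 → Finset ℕ, (∀ a j, (r a j : Set ℕ) ⊆ S a) ∧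
      (∀ a j b k, (a, j) ≠ (b, k) → Disjoint (r a j) (r b k)) ∧
      ∀ k, {a | ¬ ∀ j, k ≤ (r a j).card ∧ (r a j : Set ℕ) ⊆ V k}.Finite := by
  classical
  choose p Q hp hQ hpd hfin using h
  let good : ι → ℕ → Prop := fun a i => a ∈ Q i ∨ 3 * i * 2 ^ (2 * i + 1) ≤ (p i a).card
  let n : ι → ℕ := fun a => Nat.findGreatest (good a) (m a)
  have ht : ∀ a, ∃ (t : Finset ℕ) (c : ℕ), (t : Set ℕ) ⊆ S a ∩ V (n a) ∧
      3 * n a * 2 ^ (c + 1) ≤ t.card ∧ (c = 2 * m a + 1 ∨ (c = 2 * n a ∧ t = p (n a) a)) := by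
    intro a
    by_cases h0 : n a = 0
    · exact ⟨∅, 2 * m a + 1, by simp, by simp [h0], Or.inl rfl⟩
    · have hg : good a (n a) := Nat.findGreatest_of_ne_zero rfl h0
      rcases hg with hg | hg
      · obtain ⟨t, ht, hc⟩ := (hQ _ a hg).exists_subset_card_eq (3 * n a * 2 ^ (2 * m a + 1 + 1))
        exact ⟨t, _, ht, hc.ge, Or.inl rfl⟩
      · exact ⟨p (n a) a, 2 * n a, hp _ _, hg, Or.inr ⟨rfl, rfl⟩⟩
  choose t c ht1 ht2 ht3 using ht
  obtain ⟨r, hr1, hr2, hr3⟩ := hall_levels t c n (by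
    intro a b hab hc
    rcases ht3 a with h1 | ⟨h1, h1'⟩ <;> rcases ht3 b with h2 | ⟨h2, h2'⟩
    · exact absurd (hm (by omega)) hab
    · omega
    · omega
    · have : n a = n b := by omega
      rw [h1', h2', this]
      exact hpd _ _ _ hab) ht2
  have hrs : ∀ a j, (r a j : Set ℕ) ⊆ S a ∩ V (n a) := fun a j =>
    (Finset.coe_subset.2 (hr1 a j)).trans (ht1 a)
  refine ⟨r, fun a j => (hrs a j).trans inter_subset_left, hr3, fun k => ?_⟩
  have f1 : {a | m a < k}.Finite := (Set.finite_lt_nat k).preimage hm.injOn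
  refine (f1.union (hfin k (3 * k * 2 ^ (2 * k + 1)))).subset ?_
  intro a ha
  by_contra hcon
  simp only [mem_union, mem_ofPred_eq, not_or, not_lt, not_and] at hcon
  apply ha
  have hg : good a k := by
    by_cases hq : a ∈ Q k
    · exact Or.inl hq
    · exact Or.inr (hcon.2 hq)
  have hk : k ≤ n a := Nat.le_findGreatest hcon.1 hg
  intro j
  exact ⟨by rw [hr2]; exact hk, (hrs a j).trans (inter_subset_right.trans (hV hk))⟩

/-- Triples `(A, B, W)`. -/
abbrev Trip := Set ℕ × Set ℕ × Set ℕ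

/-- The inductive requirement at stage `α`. -/
def Good (α : Ordinal) (f : Iio α → Trip) (t : Trip) : Prop :=
  (Disjoint t.1 t.2.1 ∧ Disjoint t.1 t.2.2 ∧ Disjoint t.2.1 t.2.2) ∧
  t.1.Infinite ∧ t.2.2.Infinite ∧
  (∀ γ, ((t.1 ∪ t.2.1 ∪ t.2.2) \ (f γ).2.2).Finite) ∧
  (∃ p : Iio α → Finset ℕ, (∀ β, (p β : Set ℕ) ⊆ (f β).1 ∩ t.2.2) ∧
    (∀ a b, a ≠ b → Disjoint (p a) (p b)) ∧ ∀ k, {a | (p a).card < k}.Finite) ∧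
  (∀ k : ℕ, {β | ¬ ∃ l : ℕ, l > k ∧ l ∈ (f β).1 ∩ t.2.1}.Finite)

lemma countable_Iio {α : Ordinal} (h : α < omega1) : Countable (Iio α) := by
  have h1 : α.card < Cardinal.aleph 1 := Cardinal.lt_ord.1 h
  rw [← Cardinal.succ_aleph0, Order.lt_succ_iff] at h1
  rw [← Cardinal.mk_le_aleph0_iff, Cardinal.mk_Iio_ordinal, Cardinal.lift_le_aleph0]
  exact h1

lemma exists_gt_of_card {s : Finset ℕ} {k : ℕ} (h : k + 2 ≤ s.card) : ∃ l ∈ s, l > k := by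
  by_contra! hc
  have : s ⊆ Finset.range (k+1) := fun x hx => by
    have := hc x hx
    simp; omega
  have := Finset.card_le_card this
  simp at this
  omega

lemma step (α : Ordinal) (hα : α < omega1) (G : Ordinal → Trip)
    (ih : ∀ γ < α, Good γ (fun β => G β) (G γ)) :
    ∃ t, Good α (fun β => G β) t := by
  classical
  have := countable_Iio hα
  obtain ⟨m, hm⟩ := exists_injective_nat (Iio α ⊕ ℕ)
  let S : Iio α ⊕ ℕ → Set ℕ := Sum.elim (fun β => (G β).1) (fun _ => univ)
  let V : ℕ → Set ℕ := fun i => {x | ∀ β : Iio α, m (Sum.inl β) ≤ i → x ∈ (G β).2.2}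
  have hV : Antitone V := fun i j hij x hx β hβ => hx β (hβ.trans hij)
  have hmain := merge m hm S V hV ?_
  · obtain ⟨r, hr1, hr2, hr3⟩ := hmain
    let R : Fin 3 → Set ℕ := fun j => ⋃ a, (r a j : Set ℕ)
    have hRd : ∀ j k, j ≠ k → Disjoint (R j) (R k) := by
      intro j k hjk
      rw [Set.disjoint_left]
      intro x hx hy
      obtain ⟨a, ha⟩ := mem_iUnion.1 hx
      obtain ⟨b, hb⟩ := mem_iUnion.1 hy
      exact Finset.disjoint_left.1 (hr2 a j b k (by simp [hjk])) ha hb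
    have hRi : ∀ j, (R j).Infinite := by
      intro j hfin
      have h2 := hr3 ((R j).ncard + 1)
      obtain ⟨a, ha⟩ := h2.infinite_compl.nonempty
      simp only [mem_compl_iff, mem_ofPred_eq, not_not] at ha
      have h3 := (ha j).1
      have h4 : ((r a j : Set ℕ)).ncard ≤ (R j).ncard :=
        Set.ncard_le_ncard (subset_iUnion (fun a => (r a j : Set ℕ)) a) hfin
      rw [Set.ncard_coe_finset] at h4
      omega
    have hRW : ∀ j (γ : Iio α), (R j \ (G γ).2.2).Finite := by
      intro j γ
      have h2 := hr3 (m (Sum.inl γ))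
      refine (h2.biUnion (fun a _ => (r a j).finite_toSet)).subset ?_
      rintro x ⟨hx, hxn⟩
      obtain ⟨a, ha⟩ := mem_iUnion.1 hx
      refine mem_biUnion ?_ ha
      intro hall
      exact hxn ((hall j).2 ha γ le_rfl)
    have hfinl : ∀ k, {β : Iio α | ¬ ∀ j, k ≤ (r (Sum.inl β) j).card}.Finite := by
      intro k
      refine ((hr3 k).preimage (Sum.inl_injective.injOn)).subset ?_
      intro β hβ hall
      exact hβ fun j => (hall j).1
    refine ⟨(R 0, R 1, R 2), ⟨hRd _ _ (by decide), hRd _ _ (by decide), hRd _ _ (by decide)⟩,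
      hRi 0, hRi 2, ?_, ⟨fun β => r (Sum.inl β) 2, ?_, ?_, ?_⟩, ?_⟩
    · intro γ
      refine (((hRW 0 γ).union (hRW 1 γ)).union (hRW 2 γ)).subset ?_
      rintro x ⟨(hx | hx) | hx, hn⟩
      · exact Or.inl (Or.inl ⟨hx, hn⟩)
      · exact Or.inl (Or.inr ⟨hx, hn⟩)
      · exact Or.inr ⟨hx, hn⟩
    · intro β x hx
      exact ⟨hr1 (Sum.inl β) 2 hx, mem_iUnion.2 ⟨_, hx⟩⟩
    · intro a b hab
      exact hr2 _ _ _ _ (by simp [hab])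
    · intro k
      refine (hfinl k).subset ?_
      intro β hβ hall
      exact absurd (hall 2) (not_le.2 hβ)
    · intro k
      refine (hfinl (k+2)).subset ?_
      intro β hβ hall
      obtain ⟨l, hl, hlk⟩ := exists_gt_of_card (hall 1)
      exact hβ ⟨l, hlk, hr1 (Sum.inl β) 1 hl, mem_iUnion.2 ⟨_, hl⟩⟩
  · intro i
    have hFfin : {β : Iio α | m (Sum.inl β) ≤ i}.Finite :=
      (Set.finite_le_nat i).preimage (f := fun β : Iio α => m (Sum.inl β))
        (hm.comp Sum.inl_injective).injOn
    rcases Set.eq_empty_or_nonempty {β : Iio α | m (Sum.inl β) ≤ i} with hF | hF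
    · have hVu : V i = univ := by
        ext x
        simp only [mem_univ, iff_true]
        intro β hβ
        have : β ∈ {β : Iio α | m (Sum.inl β) ≤ i} := hβ
        rw [hF] at this
        exact this.elim
      refine ⟨fun _ => ∅, univ, by simp, ?_, by simp, by simp⟩
      rintro (β | n) -
      · rw [hVu, inter_univ]
        exact (ih β β.2).2.1
      · rw [hVu, inter_univ]
        exact infinite_univ
    · obtain ⟨g, hgF, hgmax⟩ := hFfin.exists_maximal hF
      have hmax : ∀ β : Iio α, m (Sum.inl β) ≤ i → β ≤ g := by
        intro β hβ
        rcases le_total β g with h | h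
        · exact h
        · exact hgmax hβ h
      have hdiff : ((G g).2.2 \ V i).Finite := by
        refine (hFfin.biUnion (t := fun β => (G g).2.2 \ (G β).2.2) ?_).subset ?_
        · intro β hβ
          rcases (hmax β hβ).lt_or_eq with h | h
          · refine ((ih g g.2).2.2.2.1 ⟨β, h⟩).subset ?_
            rintro x ⟨hx, hn⟩
            exact ⟨Or.inr hx, hn⟩
          · subst h; simp
        · rintro x ⟨hx, hn⟩
          simp only [V, mem_ofPred_eq, not_forall] at hn
          obtain ⟨β, hβ, hn⟩ := hn
          exact mem_biUnion (show β ∈ {β : Iio α | m (Sum.inl β) ≤ i} from hβ) ⟨hx, hn⟩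
      obtain ⟨-, -, hWinf, -, ⟨p, hp1, hp2, hp3⟩, -⟩ := ih g g.2
      let D := hdiff.toFinset
      let p' : Iio α ⊕ ℕ → Finset ℕ := Sum.elim
        (fun β => if h : β.1 < g.1 then p ⟨β.1, h⟩ \ D else ∅) (fun _ => ∅)
      refine ⟨p', {a | ∀ β, a = Sum.inl β → g < β}, ?_, ?_, ?_, ?_⟩
      · rintro (β | n)
        · by_cases h : β.1 < g.1
          · simp only [p', Sum.elim_inl, dif_pos h]
            intro x hx
            simp only [Finset.coe_sdiff, mem_sdiff, Finset.mem_coe, D, Finite.mem_toFinset,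
              not_and, not_not] at hx
            have h1 := hp1 ⟨β.1, h⟩ hx.1
            exact ⟨h1.1, hx.2 h1.2⟩
          · simp only [p', Sum.elim_inl, dif_neg h]; simp
        · simp [p']
      · rintro (β | n) ha
        · have hgb : g < β := ha β rfl
          obtain ⟨-, hA, -, hsub, -, -⟩ := ih β β.2
          have h1 := hsub ⟨g, hgb⟩
          intro hfin
          apply hA
          refine ((hfin.union h1).union hdiff).subset ?_
          intro x hx
          by_cases hxg : x ∈ (G g).2.2
          · by_cases hxV : x ∈ V i
            · exact Or.inl (Or.inl ⟨hx, hxV⟩)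
            · exact Or.inr ⟨hxg, hxV⟩
          · exact Or.inl (Or.inr ⟨Or.inl (Or.inl hx), hxg⟩)
        · intro hfin
          apply hWinf
          refine (hfin.union hdiff).subset ?_
          intro x hx
          by_cases hxV : x ∈ V i
          · exact Or.inl ⟨trivial, hxV⟩
          · exact Or.inr ⟨hx, hxV⟩
      · rintro (a | a) (b | b) hab
        · by_cases h : a.1 < g.1
          · by_cases h' : b.1 < g.1
            · simp only [p', Sum.elim_inl, dif_pos h, dif_pos h']
              have hne : (⟨a.1, h⟩ : Iio g.1) ≠ ⟨b.1, h'⟩ := by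
                intro he
                apply hab
                congr 1
                exact Subtype.ext (Subtype.mk.inj he)
              exact (hp2 _ _ hne).mono Finset.sdiff_subset Finset.sdiff_subset
            · simp only [p', Sum.elim_inl, dif_neg h']; simp
          · simp only [p', Sum.elim_inl, dif_neg h]; simp
        all_goals simp [p']
      · intro k
        have f1 := ((hp3 (k + D.card)).image
          (fun β : Iio g.1 => (Sum.inl ⟨β.1, mem_Iio.2 (lt_trans (mem_Iio.1 β.2) (mem_Iio.1 g.2))⟩ : Iio α ⊕ ℕ)))
        refine (f1.union (Set.finite_singleton (Sum.inl g))).subset ?_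
        rintro (β | n) ⟨hQ, hc⟩
        · have hle : β ≤ g := by
            by_contra hcon
            apply hQ
            rintro β' hβ'
            cases hβ'
            exact not_le.1 hcon
          rcases hle.lt_or_eq with h | h
          · left
            have h' : β.1 < g.1 := h
            refine ⟨⟨β.1, h'⟩, ?_, rfl⟩
            simp only [p', Sum.elim_inl, dif_pos h'] at hc
            have := Finset.le_card_sdiff D (p ⟨β.1, h'⟩)
            simp only [mem_ofPred_eq]
            omega
          · right; rw [h]; rfl
        · exact (hQ (by rintro β hβ; cases hβ)).elim

open Classical in
/-- The recursive choice of the triples. -/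
noncomputable def chosen : Ordinal → Trip :=
  WellFounded.fix (C := fun _ => Trip) (wellFounded_lt (α := Ordinal)) fun α f =>
    if h : ∃ t, Good α (fun β => f β.1 β.2) t then h.choose else default

lemma chosen_good (α : Ordinal) (hα : α < omega1) : Good α (fun β => chosen β) (chosen α) := by
  classical
  induction α using WellFoundedLT.induction with
  | ind α ih =>
    have h := step α hα chosen fun γ hγ => ih γ hγ (hγ.trans hα)
    have e : chosen α = if h : ∃ t, Good α (fun β => chosen β.1) t then h.choose else default := by
      conv_lhs => rw [chosen, WellFounded.fix_eq]
      rfl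
    rw [e, dif_pos h]
    exact h.choose_spec

theorem exists_luzin_family_with_separations :
    ∃ X Y A B : Ordinal → Set ℕ,
      (∀ α : Ordinal, α < omega1 →
        X α = A α ∪ B α ∧ (X α).Infinite ∧ A α ∩ B α = ∅) ∧
      (∀ β α : Ordinal, β < α → α < omega1 → (X β ∩ X α).Finite) ∧
      (∀ β α : Ordinal, β < α → α < omega1 → (Y β \ Y α).Finite) ∧
      (∀ β α : Ordinal, β < α → α < omega1 → (X β \ Y α).Finite) ∧
      (∀ α : Ordinal, α < omega1 → X α ∩ Y α = ∅) ∧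
      (∀ α : Ordinal, α < omega1 → ∀ k : ℕ,
        {β : Ordinal | β < α ∧ ¬ ∃ l : ℕ, l > k ∧ l ∈ A β ∩ B α}.Finite) := by
  have hdis : ∀ β < omega1, ∀ x ∈ (chosen β).1 ∪ (chosen β).2.1, x ∉ (chosen β).2.2 := by
    intro β hβ x hx hW
    obtain ⟨⟨-, h2, h3⟩, -⟩ := chosen_good β hβ
    rcases hx with hx | hx
    · exact Set.disjoint_left.1 h2 hx hW
    · exact Set.disjoint_left.1 h3 hx hW
  have hsub : ∀ β α, β < α → α < omega1 →
      (((chosen α).1 ∪ (chosen α).2.1 ∪ (chosen α).2.2) \ (chosen β).2.2).Finite :=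
    fun β α hβα hα => (chosen_good α hα).2.2.2.1 ⟨β, hβα⟩
  refine ⟨fun α => (chosen α).1 ∪ (chosen α).2.1,
    fun α => ((chosen α).1 ∪ (chosen α).2.1 ∪ (chosen α).2.2)ᶜ,
    fun α => (chosen α).1, fun α => (chosen α).2.1, ?_, ?_, ?_, ?_, ?_, ?_⟩
  · intro α hα
    obtain ⟨⟨h1, -, -⟩, h2, -⟩ := chosen_good α hα
    exact ⟨rfl, h2.mono subset_union_left, h1.inter_eq⟩
  · intro β α hβα hα
    refine (hsub β α hβα hα).subset ?_
    rintro x ⟨hx, hy⟩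
    exact ⟨Or.inl hy, hdis β (hβα.trans hα) x hx⟩
  · intro β α hβα hα
    refine (hsub β α hβα hα).subset ?_
    rintro x ⟨hx, hy⟩
    exact ⟨not_not.1 hy, fun h => hx (Or.inr h)⟩
  · intro β α hβα hα
    refine (hsub β α hβα hα).subset ?_
    rintro x ⟨hx, hy⟩
    exact ⟨not_not.1 hy, hdis β (hβα.trans hα) x hx⟩
  · intro α hα
    ext x
    simp only [mem_inter_iff, mem_empty_iff_false, iff_false, not_and]
    exact fun hx hy => hy (Or.inl hx)
  · intro α hα k
    obtain ⟨-, -, -, -, -, h⟩ := chosen_good α hα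
    refine ((h k).image Subtype.val).subset ?_
    rintro β ⟨hβ, hn⟩
    exact ⟨⟨β, hβ⟩, hn, rfl⟩
end

section
/- There exist families (X'_α)_{α<ω₁}, (Y'_α)_{α<ω₁} of subsets of ℕ and bijections f_α : ℕ × ℕ → X'_α (for each α < ω₁) such that: (1) X'_β ∩ X'_α is finite for all β < α < ω₁; (2) Y'_β \ Y'_α is finite for all β < α < ω₁; (3) X'_β \ Y'_α is finite for all β < α < ω₁; (4) X'_α ∩ Y'_α = ∅ for all α < ω₁; (5) for every α < ω₁ and every k ≥ 1, for all but finitely many β < α there exist natural numbers m₁ < … < m_k and n₁ < … < n_k such that f_α(i, n_j) = f_β(j, m_i) for all 1 ≤ i, j ≤ k. -/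
open Set

/-- diagonalisation lemma -/
lemma luz_diag {G : Type*} (S : Set G) (idx : G → ℕ) (hidx : ∀ k, {g | g ∈ S ∧ idx g < k}.Finite)
    (P : ℕ → G → Prop) (h0 : ∀ g, P 0 g) (hP : ∀ n, {g | g ∈ S ∧ ¬ P n g}.Finite) :
    ∃ N : G → ℕ, (∀ g, P (N g) g) ∧ ∀ k, {g | g ∈ S ∧ N g < k}.Finite := by
  classical
  refine ⟨fun g => Nat.findGreatest (fun n => P n g) (idx g), fun g => ?_, fun k => ?_⟩
  · exact Nat.findGreatest_spec (P := fun n => P n g) (Nat.zero_le _) (h0 g)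
  · refine ((hidx k).union (hP k)).subset ?_
    rintro g ⟨hg, hk⟩
    by_cases h : idx g < k
    · exact Or.inl ⟨hg, h⟩
    · refine Or.inr ⟨hg, fun hp => ?_⟩
      have := Nat.le_findGreatest (P := fun n => P n g) (not_lt.1 h) hp
      exact absurd hk (not_lt.2 this)

/-- the data chosen at each stage -/
structure LuzT where
  c : ℕ → ℕ
  q : ℕ → ℕ
  v : ℕ → ℕ

/-- the inductive requirements at stage `a` -/
structure LuzG {G : Type*} [LinearOrder G] (a : G) (F : G → LuzT) (t : LuzT) : Prop where
  cv : ∀ x, t.c x ≤ t.v x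
  qx : ∀ x, t.q x ≤ x
  qc : ∀ x, t.q x ≤ t.c x
  qt : ∀ L, ∃ M, ∀ x ≥ M, L ≤ t.q x
  cc : ∀ b < a, ∀ L, ∃ M, ∀ x ≥ M, (F b).c x + L ≤ t.c x
  qq : ∀ b < a, ∃ M, ∀ x ≥ M, t.q x < (F b).q x
  vv : ∀ b < a, ∃ M, ∀ x ≥ M, (F b).v x ≤ t.v x
  lz : ∀ L, {g | g < a ∧ ¬ ∃ x ≥ L, t.c x + L ≤ (F g).c x ∧ (F g).c x ≤ t.v x ∧
    t.q x ≤ (F g).q x}.Finite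

lemma luz_congr {G : Type*} [LinearOrder G] {a : G} {F F' : G → LuzT} {t : LuzT}
    (h : ∀ b < a, F b = F' b) (H : LuzG a F t) : LuzG a F' t where
  cv := H.cv
  qx := H.qx
  qc := H.qc
  qt := H.qt
  cc := fun b hb => by rw [← h b hb]; exact H.cc b hb
  qq := fun b hb => by rw [← h b hb]; exact H.qq b hb
  vv := fun b hb => by rw [← h b hb]; exact H.vv b hb
  lz := fun L => by
    refine (H.lz L).subset ?_
    rintro g ⟨hg, hn⟩
    refine ⟨hg, ?_⟩
    rw [h g hg]; exact hn

lemma luz_event {G : Type*} (D : Finset G) (P : G → ℕ → Prop)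
    (h : ∀ b ∈ D, ∃ M, ∀ x ≥ M, P b x) : ∃ M, ∀ x ≥ M, ∀ b ∈ D, P b x := by
  have : ∀ᶠ x in Filter.atTop, ∀ b ∈ D, P b x := by
    rw [Filter.eventually_all_finset]
    intro b hb
    exact Filter.eventually_atTop.2 (h b hb)
  exact Filter.eventually_atTop.1 this

/-- key claim -/
lemma luz_key {G : Type*} [LinearOrder G] (a : G) (F : G → LuzT)
    (hF : ∀ b < a, LuzG b F (F b)) (D : Finset G) (hD : ∀ b ∈ D, b < a) (n : ℕ) :
    {g | g ∈ Iio a ∧ ¬ ∃ x ≥ n, (∀ b ∈ D, (F b).c x + 2 * n ≤ (F g).c x) ∧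
      2 * n ≤ (F g).q x}.Finite := by
  rcases D.eq_empty_or_nonempty with rfl | hne
  · refine Set.finite_empty.subset ?_
    rintro g ⟨hg, hn⟩
    apply hn
    obtain ⟨M, hM⟩ := (hF g hg).qt (2 * n)
    exact ⟨max M n, le_max_right _ _, by simp, hM _ (le_max_left _ _)⟩
  · set s := D.max' hne with hs
    have hsD : s ∈ D := D.max'_mem hne
    have hsa := hD s hsD
    obtain ⟨M, hM⟩ := luz_event D (fun b x => (F b).c x ≤ (F s).c x) (by
      intro b hb
      rcases (D.le_max' b hb).lt_or_eq with h | h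
      · obtain ⟨M, hM⟩ := (hF s hsa).cc b h 0
        exact ⟨M, fun x hx => by simpa using hM x hx⟩
      · exact ⟨0, fun x _ => by rw [h]⟩)
    obtain ⟨M', hM'⟩ := (hF s hsa).qt (2 * n)
    refine (((hF s hsa).lz (M + M' + 2 * n)).union (Set.finite_singleton s)).subset ?_
    rintro g ⟨hg, hn⟩
    rcases lt_trichotomy g s with h | h | h
    · refine Or.inl ⟨h, ?_⟩
      rintro ⟨x, hx, h1, h2, h3⟩
      refine hn ⟨x, by omega, fun b hb => ?_, (hM' x (by omega)).trans h3⟩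
      have := hM x (by omega) b hb
      omega
    · exact Or.inr h
    · exfalso
      obtain ⟨K, hK⟩ := (hF g hg).cc s h (2 * n)
      obtain ⟨K', hK'⟩ := (hF g hg).qt (2 * n)
      refine hn ⟨M + K + K' + n, by omega, fun b hb => ?_, hK' _ (by omega)⟩
      have h1 := hM (M + K + K' + n) (by omega) b hb
      have h2 := hK (M + K + K' + n) (by omega)
      omega

lemma luz_step {G : Type*} [LinearOrder G] (a : G) (hc : (Iio a).Countable) (F : G → LuzT)
    (hF : ∀ b < a, LuzG b F (F b)) : ∃ t, LuzG a F t := by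
  classical
  obtain ⟨idx, hidx⟩ := Set.countable_iff_exists_injOn.1 hc
  have hfin : ∀ k, {g | g ∈ Iio a ∧ idx g < k}.Finite := by
    intro k
    refine Set.Finite.of_finite_image ((Set.finite_Iio k).subset ?_)
      (f := idx) (hidx.mono fun g hg => hg.1)
    rintro _ ⟨g, hg, rfl⟩
    exact hg.2
  let D : ℕ → Finset G := fun k => (hfin k).toFinset
  have hD : ∀ k g, g ∈ D k ↔ g < a ∧ idx g < k := by
    intro k g; simp [D]
  obtain ⟨n, hn, hnf⟩ := luz_diag (Iio a) idx hfin
    (fun n g => n = 0 ∨ ∃ x ≥ n, (∀ b ∈ D n, (F b).c x + 2 * n ≤ (F g).c x) ∧ 2 * n ≤ (F g).q x)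
    (fun g => Or.inl rfl) (by
      intro n
      refine (luz_key a F hF (D n) (fun b hb => ((hD _ _).1 hb).1) n).subset ?_
      rintro g ⟨hg, h⟩
      exact ⟨hg, fun h' => h (Or.inr h')⟩)
  have hx : ∀ g, ∃ x ≥ n g, n g = 0 ∨
      ((∀ b ∈ D (n g), (F b).c x + 2 * n g ≤ (F g).c x) ∧ 2 * n g ≤ (F g).q x) := by
    intro g
    rcases hn g with h | ⟨x, h1, h2⟩
    · exact ⟨0, by omega, Or.inl h⟩
    · exact ⟨x, h1, Or.inr h2⟩
  choose X hXn hX using hx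
  have hXfin : ∀ x, {g | g ∈ Iio a ∧ X g = x}.Finite := by
    intro x
    refine (hnf (x + 1)).subset ?_
    rintro g ⟨hg, rfl⟩
    exact ⟨hg, Nat.lt_succ_of_le (hXn g)⟩
  obtain ⟨N, hN, hNf⟩ := luz_diag (Set.univ : Set ℕ) id
    (fun k => (Set.finite_Iio k).subset fun x hx => hx.2)
    (fun k x => k ≤ x ∧ (∀ g < a, X g = x → k ≤ n g) ∧ ∀ b ∈ D k, k < (F b).q x)
    (fun x => ⟨by omega, fun _ _ _ => by omega, fun b hb => by
      have := ((hD _ _).1 hb).2; omega⟩) (by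
      intro k
      obtain ⟨M, hM⟩ := luz_event (D k) (fun b x => k < (F b).q x) (by
        intro b hb
        exact (hF b ((hD _ _).1 hb).1).qt (k + 1))
      refine (((Set.finite_Iio (M + k)).union ((hnf k).image X))).subset ?_
      rintro x ⟨-, hx⟩
      by_contra hcon
      simp only [Set.mem_union, Set.mem_Iio, Set.mem_image, not_or, not_exists, not_and,
        Set.mem_ofPred_eq, not_lt] at hcon
      refine hx ⟨by omega, fun g hg hgx => ?_, fun b hb => hM x (by omega) b hb⟩
      by_contra hlt
      exact hcon.2 g ⟨hg, not_le.1 hlt⟩ hgx)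
  have hNt : ∀ L, ∃ M, ∀ x ≥ M, L ≤ N x := by
    intro L
    obtain ⟨M, hM⟩ := (hNf L).bddAbove
    refine ⟨M + 1, fun x hx => ?_⟩
    by_contra hlt
    have := hM (show x ∈ {g | g ∈ Set.univ ∧ N g < L} from ⟨trivial, not_le.1 hlt⟩)
    omega
  let c : ℕ → ℕ := fun x => (D (N x)).sup (fun b => (F b).c x) + N x
  let v : ℕ → ℕ := fun x => c x + (D x).sup (fun b => (F b).v x) +
    (hXfin x).toFinset.sup (fun g => (F g).c x)
  refine ⟨⟨c, N, v⟩, ?_, ?_, ?_, hNt, ?_, ?_, ?_, ?_⟩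
  · intro x; simp only [v]; omega
  · intro x; exact (hN x).1
  · intro x; simp only [c]; omega
  · intro b hb L
    obtain ⟨M, hM⟩ := hNt (L + idx b + 1)
    refine ⟨M, fun x hx => ?_⟩
    have h1 := hM x hx
    have h2 : (F b).c x ≤ (D (N x)).sup (fun b => (F b).c x) :=
      Finset.le_sup (f := fun b => (F b).c x) ((hD _ _).2 ⟨hb, by omega⟩)
    simp only [c]; omega
  · intro b hb
    obtain ⟨M, hM⟩ := hNt (idx b + 1)
    refine ⟨M, fun x hx => (hN x).2.2 b ((hD _ _).2 ⟨hb, ?_⟩)⟩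
    have h1 := hM x hx
    omega
  · intro b hb
    refine ⟨idx b + 1, fun x hx => ?_⟩
    have h2 : (F b).v x ≤ (D x).sup (fun b => (F b).v x) :=
      Finset.le_sup (f := fun b => (F b).v x) ((hD _ _).2 ⟨hb, by omega⟩)
    simp only [v]; omega
  · intro L
    refine (hnf (L + 1)).subset ?_
    rintro g ⟨hg, hcon⟩
    refine ⟨hg, ?_⟩
    by_contra hlt
    apply hcon
    have h1 := hXn g
    have h2 := (hN (X g)).2.1 g hg rfl
    rcases hX g with h0 | ⟨h3, h4⟩
    · omega
    refine ⟨X g, by omega, ?_, ?_, by dsimp only; omega⟩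
    · have h5 : (D (N (X g))).sup (fun b => (F b).c (X g)) ≤ (F g).c (X g) - 2 * n g := by
        refine Finset.sup_le fun b hb => ?_
        have hb' := (hD _ _).1 hb
        have := h3 b ((hD _ _).2 ⟨hb'.1, by omega⟩)
        omega
      have h6 := (hF g hg).qc (X g)
      simp only [c]; omega
    · have : (F g).c (X g) ≤ (hXfin (X g)).toFinset.sup (fun g' => (F g').c (X g)) :=
        Finset.le_sup (f := fun g' => (F g').c (X g)) (by simpa using hg)
      simp only [v]; omega


lemma luz_rec {G : Type*} [LinearOrder G] [WellFoundedLT G] :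
    ∃ F : G → LuzT, ∀ a, (Iio a).Countable → LuzG a F (F a) := by
  classical
  let dft : LuzT := ⟨fun _ => 0, fun _ => 0, fun _ => 0⟩
  let ext : ∀ a : G, (∀ b, b < a → LuzT) → G → LuzT :=
    fun a p b => if h : b < a then p b h else dft
  let H : ∀ a : G, (∀ b, b < a → LuzT) → LuzT :=
    fun a p => if h : ∃ t, LuzG a (ext a p) t then h.choose else dft
  let F : G → LuzT := (wellFounded_lt (α := G)).fix H
  have hF : ∀ a, F a = H a (fun b _ => F b) := fun a => WellFounded.fix_eq _ _ _
  refine ⟨F, fun a => ?_⟩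
  induction a using (wellFounded_lt (α := G)).induction with
  | _ a ih =>
    intro hc
    have he : ∀ b < a, F b = ext a (fun b _ => F b) b := by
      intro b hb
      simp only [ext, dif_pos hb]
    obtain ⟨t, ht⟩ := luz_step a hc F
      (fun b hb => ih b hb (hc.mono (Iio_subset_Iio hb.le)))
    have hex : ∃ t, LuzG a (ext a (fun b _ => F b)) t := ⟨t, luz_congr he ht⟩
    have : F a = hex.choose := by
      rw [hF a]; simp only [H]; rw [dif_pos hex]
    rw [this]
    exact luz_congr (fun b hb => (he b hb).symm) hex.choose_spec

/-- the injection at a stage; points are `(x, l, r, i, j)` -/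
def luzF (t : LuzT) (p : ℕ × ℕ) : ℕ × ℕ × ℕ × ℕ × ℕ :=
  if 1 ≤ p.1 ∧ p.1 ≤ p.2.unpair.1.unpair.1 ∧ p.2.unpair.2 < p.2.unpair.1.unpair.1 ∧
      p.2.unpair.1.unpair.2 % 2 = 0 ∧
      t.c p.2.unpair.1.unpair.1 < p.2.unpair.1.unpair.2 / 2 ∧
      p.2.unpair.1.unpair.2 / 2 ≤ t.v p.2.unpair.1.unpair.1 then
    (p.2.unpair.1.unpair.1, p.2.unpair.1.unpair.2 / 2, t.q p.2.unpair.1.unpair.1,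
      p.1 - 1, p.2.unpair.2)
  else if 1 ≤ p.1 ∧ p.1 ≤ p.2.unpair.1.unpair.1 ∧ p.2.unpair.2 < p.2.unpair.1.unpair.1 ∧
      p.2.unpair.1.unpair.2 % 2 = 1 ∧
      p.2.unpair.1.unpair.2 / 2 ≤ t.q p.2.unpair.1.unpair.1 then
    (p.2.unpair.1.unpair.1, t.c p.2.unpair.1.unpair.1, p.2.unpair.1.unpair.2 / 2,
      p.2.unpair.2, p.1 - 1)
  else (Nat.pair p.1 p.2, t.c (Nat.pair p.1 p.2), t.q (Nat.pair p.1 p.2),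
      Nat.pair p.1 p.2, Nat.pair p.1 p.2)

lemma luz_unpair_ext {b b' : ℕ} (h1 : b.unpair.1.unpair.1 = b'.unpair.1.unpair.1)
    (h2 : b.unpair.1.unpair.2 = b'.unpair.1.unpair.2) (h3 : b.unpair.2 = b'.unpair.2) :
    b = b' := by
  rw [← Nat.pair_unpair b, ← Nat.pair_unpair b', ← Nat.pair_unpair b.unpair.1,
    ← Nat.pair_unpair b'.unpair.1, h1, h2, h3]

lemma luzF_inj (t : LuzT) : Function.Injective (luzF t) := by
  rintro ⟨a, b⟩ ⟨a', b'⟩ h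
  unfold luzF at h
  dsimp only at h
  split_ifs at h with h1 h2 h3 h4 h5 h6 h7 h8 <;> simp only [Prod.mk.injEq] at h ⊢ <;>
    obtain ⟨e1, e2, e3, e4, e5⟩ := h
  all_goals first
    | exact ⟨by omega, luz_unpair_ext e1 (by omega) (by omega)⟩
    | (exfalso; rw [e1] at *; omega)
    | (exfalso; rw [← e1] at *; omega)
    | exact Nat.pair_eq_pair.1 e1

/-- a superset of the range -/
def luzE (t : LuzT) : Set (ℕ × ℕ × ℕ × ℕ × ℕ) :=
  {p | p.2.2.2.1 ≤ p.1 ∧ p.2.2.2.2 ≤ p.1 ∧ ((p.2.1 = t.c p.1 ∧ p.2.2.1 ≤ t.q p.1) ∨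
    (t.c p.1 < p.2.1 ∧ p.2.1 ≤ t.v p.1 ∧ p.2.2.1 = t.q p.1))}

/-- the separation -/
def luzY (t : LuzT) : Set (ℕ × ℕ × ℕ × ℕ × ℕ) :=
  {p | p.2.2.2.1 ≤ p.1 ∧ p.2.2.2.2 ≤ p.1 ∧ p.2.2.1 ≤ p.1 ∧ (p.2.1 < t.c p.1 ∨
    (p.2.1 ≤ t.v p.1 ∧ t.q p.1 < p.2.2.1))}

lemma luzF_mem (t : LuzT) (p : ℕ × ℕ) : luzF t p ∈ luzE t := by
  unfold luzF luzE
  split_ifs with h1 h2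
  · refine ⟨?_, ?_, Or.inr ⟨h1.2.2.2.2.1, h1.2.2.2.2.2, rfl⟩⟩ <;> dsimp only <;> omega
  · refine ⟨?_, ?_, Or.inl ⟨rfl, h2.2.2.2.2⟩⟩ <;> dsimp only <;> omega
  · exact ⟨le_rfl, le_rfl, Or.inl ⟨rfl, le_rfl⟩⟩

lemma luz_fin (v : ℕ → ℕ) (M : ℕ) (S : Set (ℕ × ℕ × ℕ × ℕ × ℕ))
    (h : ∀ x l r i j, (x, l, r, i, j) ∈ S → x < M ∧ l ≤ v x ∧ r ≤ x ∧ i ≤ x ∧ j ≤ x) :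
    S.Finite := by
  refine ((Set.finite_Iio M).prod ((Set.finite_Iic ((Finset.range M).sup v)).prod
    ((Set.finite_Iio M).prod ((Set.finite_Iio M).prod (Set.finite_Iio M))))).subset ?_
  rintro ⟨x, l, r, i, j⟩ hS
  obtain ⟨h1, h2, h3, h4, h5⟩ := h x l r i j hS
  have : v x ≤ (Finset.range M).sup v := Finset.le_sup (Finset.mem_range.2 h1)
  simp only [Set.mem_prod, Set.mem_Iio, Set.mem_Iic]
  omega

lemma luz_events {G : Type*} [LinearOrder G] {a b : G} {F : G → LuzT} (hab : b < a)
    (ha : LuzG a F (F a)) : ∃ M, ∀ x ≥ M, (F b).c x < (F a).c x ∧ (F a).q x < (F b).q x ∧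
      (F b).v x ≤ (F a).v x := by
  obtain ⟨M1, h1⟩ := ha.cc b hab 1
  obtain ⟨M2, h2⟩ := ha.qq b hab
  obtain ⟨M3, h3⟩ := ha.vv b hab
  exact ⟨M1 + M2 + M3, fun x hx => ⟨h1 x (by omega), h2 x (by omega), h3 x (by omega)⟩⟩

lemma luz_EY {G : Type*} [LinearOrder G] {a b : G} {F : G → LuzT} (hab : b < a)
    (ha : LuzG a F (F a)) (hb : LuzG b F (F b)) : (luzE (F b) \ luzY (F a)).Finite := by
  obtain ⟨M, hM⟩ := luz_events hab ha
  refine luz_fin (F b).v M _ ?_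
  rintro x l r i j ⟨h1, h2⟩
  simp only [luzE, luzY, Set.mem_ofPred_eq] at h1 h2
  have e1 := hb.cv x
  have e2 := hb.qx x
  have e3 : x < M := by
    by_contra hx
    have := hM x (not_lt.1 hx)
    apply h2
    omega
  omega

lemma luz_YY {G : Type*} [LinearOrder G] {a b : G} {F : G → LuzT} (hab : b < a)
    (ha : LuzG a F (F a)) (hb : LuzG b F (F b)) : (luzY (F b) \ luzY (F a)).Finite := by
  obtain ⟨M, hM⟩ := luz_events hab ha
  refine luz_fin (F b).v M _ ?_
  rintro x l r i j ⟨h1, h2⟩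
  simp only [luzY, Set.mem_ofPred_eq] at h1 h2
  have e1 := hb.cv x
  have e3 : x < M := by
    by_contra hx
    have := hM x (not_lt.1 hx)
    apply h2
    omega
  omega

lemma luz_disj (t : LuzT) (p) (h1 : p ∈ luzE t) (h2 : p ∈ luzY t) : False := by
  simp only [luzE, luzY, Set.mem_ofPred_eq] at h1 h2
  omega

lemma luz_countable (a : Ordinal) (ha : a < omega1) : (Iio a).Countable := by
  have h : a.card < Cardinal.aleph 1 := Cardinal.lt_ord.1 ha
  rw [← Cardinal.le_aleph0_iff_set_countable, Cardinal.mk_Iio_ordinal, Cardinal.lift_le_aleph0]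
  exact Cardinal.lt_aleph_one_iff.1 h

theorem exists_luzin_family_with_separations_and_bijections :
    ∃ (X Y : Ordinal → Set ℕ) (f : Ordinal → ℕ × ℕ → ℕ),
      (∀ α : Ordinal, α < omega1 →
        Function.Injective (f α) ∧ Set.range (f α) = X α) ∧
      (∀ β α : Ordinal, β < α → α < omega1 → (X β ∩ X α).Finite) ∧
      (∀ β α : Ordinal, β < α → α < omega1 → (Y β \ Y α).Finite) ∧
      (∀ β α : Ordinal, β < α → α < omega1 → (X β \ Y α).Finite) ∧
      (∀ α : Ordinal, α < omega1 → X α ∩ Y α = ∅) ∧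
      (∀ α : Ordinal, α < omega1 → ∀ k : ℕ, 1 ≤ k →
        {β : Ordinal | β < α ∧ ¬ ∃ m n : Fin k → ℕ, StrictMono m ∧ StrictMono n ∧
          ∀ i j : Fin k, f α ((i : ℕ) + 1, n j) = f β ((j : ℕ) + 1, m i)}.Finite) := by
  obtain ⟨F, hF'⟩ := luz_rec (G := Ordinal)
  have hF : ∀ a, a < omega1 → LuzG a F (F a) := fun a ha => hF' a (luz_countable a ha)
  let e : (ℕ × ℕ × ℕ × ℕ × ℕ) ≃ ℕ := Denumerable.eqv _
  have hsub : ∀ a, Set.range (fun p => e (luzF (F a) p)) ⊆ e '' luzE (F a) := by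
    rintro a _ ⟨p, rfl⟩
    exact ⟨_, luzF_mem _ p, rfl⟩
  have hXY : ∀ β α : Ordinal, β < α → α < omega1 →
      (Set.range (fun p => e (luzF (F β) p)) \ e '' luzY (F α)).Finite := by
    intro b a hab ha
    refine ((luz_EY hab (hF a ha) (hF b (hab.trans ha))).image e).subset ?_
    rw [Set.image_sdiff e.injective]
    exact Set.sdiff_subset_sdiff_left (hsub b)
  have hdis : ∀ a, Set.range (fun p => e (luzF (F a) p)) ∩ e '' luzY (F a) = ∅ := by
    intro a
    rw [Set.eq_empty_iff_forall_notMem]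
    rintro _ ⟨⟨p, rfl⟩, y, hy, hyp⟩
    have := e.injective hyp
    subst this
    exact luz_disj _ _ (luzF_mem _ p) hy
  refine ⟨fun a => Set.range (fun p => e (luzF (F a) p)), fun a => e '' luzY (F a),
    fun a p => e (luzF (F a) p), ?_, ?_, ?_, hXY, fun a _ => hdis a, ?_⟩
  · exact fun a _ => ⟨e.injective.comp (luzF_inj _), rfl⟩
  · intro b a hab ha
    refine (hXY b a hab ha).subset ?_
    rintro y ⟨h1, h2⟩
    refine ⟨h1, fun h3 => ?_⟩
    have : y ∈ (∅ : Set ℕ) := by rw [← hdis a]; exact ⟨h2, h3⟩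
    exact this
  · intro b a hab ha
    rw [← Set.image_sdiff e.injective]
    exact (luz_YY hab (hF a ha) (hF b (hab.trans ha))).image e
  · intro a ha k hk
    refine ((hF a ha).lz k).subset ?_
    rintro b ⟨hb, hn⟩
    refine ⟨hb, ?_⟩
    rintro ⟨x, hx, h1, h2, h3⟩
    apply hn
    refine ⟨fun i => Nat.pair (Nat.pair x (2 * (F a).q x + 1)) i,
      fun j => Nat.pair (Nat.pair x (2 * (F b).c x)) j,
      fun i j hij => Nat.pair_lt_pair_right _ hij, fun i j hij => Nat.pair_lt_pair_right _ hij, ?_⟩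
    intro i j
    have hi := i.2
    have hj := j.2
    have d1 : 2 * (F b).c x / 2 = (F b).c x := by omega
    have d2 : (2 * (F a).q x + 1) / 2 = (F a).q x := by omega
    refine congrArg e ?_
    unfold luzF
    simp only [Nat.unpair_pair, d1, d2]
    rw [if_pos (by omega), if_neg (by omega), if_pos (by omega)]
    simp
end

section
/- There exists an almost disjoint family 𝒜 of infinite subsets of ℕ of cardinality ℵ₁ which is inseparable (no two disjoint uncountable subfamilies of 𝒜 are separated) but such that for every countable subfamily ℬ ⊆ 𝒜, the families ℬ and 𝒜 \ ℬ are separated. -/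
open Set

/-- An almost disjoint family: an infinite family of infinite subsets of `ℕ`
with pairwise finite intersections. -/
def IsAlmostDisjointFamily (𝒜 : Set (Set ℕ)) : Prop :=
  𝒜.Infinite ∧ (∀ A ∈ 𝒜, A.Infinite) ∧
    ∀ A ∈ 𝒜, ∀ B ∈ 𝒜, A ≠ B → (A ∩ B).Finite

/-- Two families `ℬ, 𝒞` of subsets of `ℕ` are separated if some `X ⊆ ℕ` almost contains
every member of `ℬ` and is almost disjoint from every member of `𝒞`. -/
def SeparatedFamilies (ℬ 𝒞 : Set (Set ℕ)) : Prop :=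
  ∃ X : Set ℕ, (∀ B ∈ ℬ, (B \ X).Finite) ∧ (∀ C ∈ 𝒞, (C ∩ X).Finite)

theorem diag_aux {J : Type} (c : J → ℕ) (hc : Function.Injective c) (Q : ℕ → J → Prop)
    (hQ : ∀ k, {j | ¬ Q k j}.Finite) :
    ∃ κ : J → ℕ, (∀ K, {j | κ j < K}.Finite) ∧ ∀ j, κ j ≠ 0 → Q (κ j) j := by
  classical
  refine ⟨fun j => Nat.findGreatest (fun k => Q k j) (c j), ?_, ?_⟩
  · intro K
    have h1 : {j | c j < K}.Finite := (Set.finite_Iio K).preimage hc.injOn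
    refine ((hQ K).union h1).subset ?_
    intro j hj
    by_contra hcon
    simp only [mem_union, mem_setOf_eq, not_or, not_not, not_lt] at hcon hj
    have := Nat.le_findGreatest (P := fun k => Q k j) hcon.2 hcon.1
    omega
  · intro j hj
    exact Nat.findGreatest_of_ne_zero (P := fun k => Q k j) rfl hj

def LipNat (v : ℕ → ℕ) : Prop := ∀ n m, v n ≤ v m + ((n - m) + (m - n))

theorem tent_aux {J : Type} (w : ℕ → ℕ → ℕ) (hanti : ∀ k l n, k ≤ l → w l n ≤ w k n)
    (hlip : ∀ k, LipNat (w k)) (hinf : ∀ k K, ∃ N, ∀ n ≥ N, K ≤ w k n)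
    (κ ν : J → ℕ) (hκ : ∀ K, {j | κ j < K}.Finite) :
    ∃ v : ℕ → ℕ, LipNat v ∧ (∀ j, w (κ j) (ν j) - κ j ≤ v (ν j)) ∧
      ∀ K, ∃ N, ∀ n ≥ N, v n + K ≤ w K n := by
  have hbdd : ∀ n, BddAbove (Set.range fun j : J =>
      w (κ j) (ν j) - κ j - ((n - ν j) + (ν j - n))) := by
    intro n
    refine ⟨w 0 n, ?_⟩
    rintro _ ⟨j, rfl⟩
    have h1 := hanti 0 (κ j) (ν j) (Nat.zero_le _)
    have h2 := hlip 0 (ν j) n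
    simp only
    omega
  refine ⟨fun n => ⨆ j, (w (κ j) (ν j) - κ j - ((n - ν j) + (ν j - n))), ?_, ?_, ?_⟩
  · intro n m
    refine ciSup_le' fun j => ?_
    have := le_ciSup (hbdd m) j
    simp only at this ⊢
    omega
  · intro j
    have := le_ciSup (hbdd (ν j)) j
    simp only at this ⊢
    omega
  · intro K
    obtain ⟨N, hN⟩ := hinf K K
    obtain ⟨M, hM⟩ := ((hκ K).image fun j => w (κ j) (ν j) + ν j).bddAbove
    refine ⟨max N M, fun n hn => ?_⟩
    have hKn := hN n (le_trans (le_max_left _ _) hn)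
    have hMn : M ≤ n := le_trans (le_max_right _ _) hn
    have : (⨆ j, (w (κ j) (ν j) - κ j - ((n - ν j) + (ν j - n)))) ≤ w K n - K := by
      refine ciSup_le' fun j => ?_
      by_cases hj : κ j < K
      · have := hM ⟨j, hj, rfl⟩
        simp only at this
        omega
      · have h1 := hanti K (κ j) (ν j) (not_lt.1 hj)
        have h2 := hlip K (ν j) n
        omega
    simp only
    omega

structure GoodAt {ι : Type} [LinearOrder ι] (α : ι) (u : ι → ℕ → ℕ) (v : ℕ → ℕ) : Prop where
  lip : LipNat v
  inf : ∀ K, ∃ N, ∀ n ≥ N, K ≤ v n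
  dec : ∀ β < α, ∀ K, ∃ N, ∀ n ≥ N, v n + K ≤ u β n
  haus : ∀ m, {γ | γ < α ∧ ∀ n ≥ m, v n < u γ n + m}.Finite

theorem step_aux {ι : Type} [LinearOrder ι] (α : ι) (hα : (Iio α).Countable) (u : ι → ℕ → ℕ)
    (hu : ∀ β < α, GoodAt β u (u β)) : ∃ v, GoodAt α u v := by
  classical
  by_cases hne : (Iio α).Nonempty
  swap
  · rw [Set.not_nonempty_iff_eq_empty] at hne
    have hno : ∀ β, ¬ β < α := fun β hβ => by
      have : β ∈ Iio α := hβ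
      rw [hne] at this
      exact this
    refine ⟨fun n => n, ⟨fun n m => by omega, fun K => ⟨K, fun n hn => hn⟩,
      fun β hβ => (hno β hβ).elim, fun m => ?_⟩⟩
    convert Set.finite_empty
    ext γ
    simp [hno γ]
  haveI : Countable (Iio α) := hα
  haveI : Nonempty (Iio α) := hne.to_subtype
  obtain ⟨e, he⟩ := exists_surjective_nat (Iio α)
  obtain ⟨c, hc⟩ := exists_injective_nat (Iio α)
  let w : ℕ → ℕ → ℕ := fun k n =>
    (Finset.range (k + 1)).inf' ⟨0, by simp⟩ (fun i => u (e i) n)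
  have hwle : ∀ k n i, i ≤ k → w k n ≤ u (e i) n := fun k n i hi =>
    Finset.inf'_le (f := fun i => u (e i) n) (Finset.mem_range.2 (by omega))
  have hlew : ∀ k n a, (∀ i ≤ k, a ≤ u (e i) n) → a ≤ w k n := fun k n a h =>
    Finset.le_inf' _ _ fun i hi => h i (by have := Finset.mem_range.1 hi; omega)
  have hanti : ∀ k l n, k ≤ l → w l n ≤ w k n := fun k l n hkl =>
    hlew _ _ _ fun i hi => hwle _ _ _ (hi.trans hkl)
  have hlip : ∀ k, LipNat (w k) := by
    intro k n m
    have : w k n - ((n - m) + (m - n)) ≤ w k m := by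
      refine hlew _ _ _ fun i hi => ?_
      have h1 := hwle k n i hi
      have h2 := (hu (e i) (e i).2).lip n m
      omega
    omega
  have hinf : ∀ k K, ∃ N, ∀ n ≥ N, K ≤ w k n := by
    intro k K
    choose N hN using fun i => (hu (e i) (e i).2).inf K
    refine ⟨(Finset.range (k + 1)).sup N, fun n hn => hlew _ _ _ fun i hi => ?_⟩
    exact hN i n (le_trans (Finset.le_sup (f := N) (Finset.mem_range.2 (by omega))) hn)
  -- first diagonalization
  obtain ⟨κ₁, hκ₁, hQ₁⟩ := diag_aux (fun n : ℕ => n) (fun _ _ h => h)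
    (fun k n => 2 * k ≤ w k n) (by
      intro k
      obtain ⟨N, hN⟩ := hinf k (2 * k)
      refine (Set.finite_Iio N).subset fun n hn => ?_
      by_contra hcon
      exact hn (hN n (not_lt.1 hcon)))
  -- second diagonalization
  obtain ⟨κ₂, hκ₂, hQ₂⟩ := diag_aux c hc
    (fun k γ => ∃ n ≥ k, u γ n + 2 * k ≤ w k n) (by
      intro k
      obtain ⟨i₀, hi₀, hmax⟩ := Finset.exists_max_image (Finset.range (k + 1)) e ⟨0, by simp⟩
      set β := e i₀ with hβ
      have hex : ∀ i, ∃ N, i ≤ k → ∀ n ≥ N, u β n ≤ u (e i) n := by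
        intro i
        by_cases hi : i ≤ k
        · rcases (hmax i (Finset.mem_range.2 (by omega))).lt_or_eq with h | h
          · obtain ⟨N, hN⟩ := (hu β β.2).dec (e i) h 0
            exact ⟨N, fun _ n hn => by simpa using hN n hn⟩
          · exact ⟨0, fun _ n _ => by rw [h]⟩
        · exact ⟨0, fun h => (hi h).elim⟩
      choose N hN using hex
      let M := (Finset.range (k + 1)).sup N
      have hM : ∀ n ≥ M, u β n ≤ w k n := fun n hn => hlew _ _ _ fun i hi =>
        hN i hi n (le_trans (Finset.le_sup (f := N) (Finset.mem_range.2 (by omega))) hn)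
      have hfin := (hu β β.2).haus (max M (2 * k))
      have hfin2 := (hfin.union (Set.finite_singleton (β : ι))).preimage
        (f := ((↑) : Iio α → ι)) Subtype.val_injective.injOn
      refine hfin2.subset fun γ hγ => ?_
      by_contra hcon
      apply hγ
      simp only [mem_preimage, mem_union, mem_setOf_eq, mem_singleton_iff, not_or] at hcon
      obtain ⟨h1, h2⟩ := hcon
      rcases lt_trichotomy (γ : ι) β with h | h | h
      · push Not at h1
        obtain ⟨n, hn, hn2⟩ := h1 h
        have := hM n (le_trans (le_max_left _ _) hn)
        have h3 := le_max_right M (2 * k)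
        exact ⟨n, by omega, by omega⟩
      · exact (h2 h).elim
      · obtain ⟨N', hN'⟩ := (hu γ γ.2).dec β h (2 * k)
        refine ⟨max N' (max M k), by simp, ?_⟩
        have h3 := hN' (max N' (max M k)) (by simp)
        have h4 := hM (max N' (max M k)) (by simp)
        omega)
  have hex : ∀ γ : Iio α, ∃ n, κ₂ γ ≠ 0 → n ≥ κ₂ γ ∧ u γ n + 2 * κ₂ γ ≤ w (κ₂ γ) n := by
    intro γ
    by_cases h : κ₂ γ ≠ 0
    · obtain ⟨n, hn⟩ := hQ₂ γ h
      exact ⟨n, fun _ => hn⟩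
    · exact ⟨0, fun h' => (h h').elim⟩
  choose ν₂ hν₂ using hex
  obtain ⟨v, hv1, hv2, hv3⟩ := tent_aux (J := ℕ ⊕ Iio α) w hanti hlip hinf
    (Sum.elim κ₁ κ₂) (Sum.elim id ν₂) (by
      intro K
      refine (((hκ₁ K).image Sum.inl).union ((hκ₂ K).image Sum.inr)).subset ?_
      rintro (n | γ) h
      · exact Or.inl ⟨n, h, rfl⟩
      · exact Or.inr ⟨γ, h, rfl⟩)
  refine ⟨v, hv1, ?_, ?_, ?_⟩
  · intro K
    obtain ⟨M, hM⟩ := (hκ₁ (K + 1)).bddAbove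
    refine ⟨M + 1, fun n hn => ?_⟩
    have h1 : ¬ κ₁ n < K + 1 := fun h => by
      have := hM h
      omega
    have h2 := hQ₁ n (by omega)
    have h3 := hv2 (Sum.inl n)
    simp only [Sum.elim_inl, id] at h3
    omega
  · intro β hβ K
    obtain ⟨i, hi⟩ := he ⟨β, hβ⟩
    obtain ⟨N, hN⟩ := hv3 (max K i)
    refine ⟨N, fun n hn => ?_⟩
    have h1 := hN n hn
    have h2 := hwle (max K i) n i (le_max_right _ _)
    have h3 := le_max_left K i
    rw [hi] at h2
    simp only at h2
    omega
  · intro m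
    refine ((hκ₂ (m + 1)).image Subtype.val).subset ?_
    rintro γ ⟨hγ, h⟩
    refine ⟨⟨γ, hγ⟩, ?_, rfl⟩
    by_contra hcon
    simp only [mem_setOf_eq, not_lt] at hcon
    obtain ⟨h1, h2⟩ := hν₂ ⟨γ, hγ⟩ (by omega)
    have h3 := hv2 (Sum.inr ⟨γ, hγ⟩)
    simp only [Sum.elim_inr] at h3 h2
    have h4 := h (ν₂ ⟨γ, hγ⟩) (by omega)
    omega

theorem rec_aux {ι X : Type} [LinearOrder ι] [WellFoundedLT ι] [Nonempty X]
    (P : ι → (ι → X) → X → Prop)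
    (hcongr : ∀ α u u' v, (∀ β < α, u β = u' β) → P α u v → P α u' v)
    (step : ∀ α u, (∀ β < α, P β u (u β)) → ∃ v, P α u v) : ∃ u, ∀ α, P α u (u α) := by
  classical
  let ext : ∀ α : ι, (∀ β, β < α → X) → ι → X := fun α g β =>
    if h : β < α then g β h else Classical.arbitrary X
  let F : ∀ α : ι, (∀ β, β < α → X) → X := fun α g => Classical.epsilon fun v => P α (ext α g) v
  let u : ι → X := (wellFounded_lt (α := ι)).fix F
  have hu : ∀ α, u α = F α fun β _ => u β := fun α => WellFounded.fix_eq _ F α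
  refine ⟨u, fun α => ?_⟩
  induction α using WellFoundedLT.induction with
  | ind α ih =>
    have hext : ∀ β < α, u β = ext α (fun β _ => u β) β := by
      intro β hβ
      simp [ext, hβ]
    obtain ⟨v, hv⟩ := step α u ih
    have h1 := hcongr α u _ v hext hv
    have h2 : P α (ext α fun β _ => u β) (F α fun β _ => u β) :=
      Classical.epsilon_spec (p := fun v => P α (ext α fun β _ => u β) v) ⟨v, h1⟩
    rw [← hu] at h2
    exact hcongr α _ u _ (fun β hβ => (hext β hβ).symm) h2

theorem seq_aux {ι : Type} [LinearOrder ι] [WellFoundedLT ι] (hι : ∀ α : ι, (Iio α).Countable) :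
    ∃ u : ι → ℕ → ℕ, ∀ α, GoodAt α u (u α) := by
  refine rec_aux (fun α u v => GoodAt α u v) ?_ fun α u hu => step_aux α (hι α) u hu
  intro α u u' v h hv
  refine ⟨hv.lip, hv.inf, fun β hβ => h β hβ ▸ hv.dec β hβ, fun m => ?_⟩
  refine (hv.haus m).subset ?_
  rintro γ ⟨hγ, h'⟩
  exact ⟨hγ, by rw [h γ hγ]; exact h'⟩

def strip (f : ℕ → ℕ) : Set ℕ :=
  {p | f p.unpair.1 ≤ p.unpair.2 ∧ p.unpair.2 ≤ f p.unpair.1 + 2}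

theorem strip_fin (f : ℕ → ℕ) (N : ℕ) (S : Set ℕ) (hS : S ⊆ strip f)
    (h : ∀ p ∈ S, p.unpair.1 < N) : S.Finite := by
  refine (((Set.finite_Iio N).biUnion fun n _ => (Set.finite_Iic (f n + 2)).image
    (fun s => Nat.pair n s))).subset ?_
  intro p hp
  simp only [mem_iUnion]
  exact ⟨p.unpair.1, h p hp, p.unpair.2, (hS hp).2, Nat.pair_unpair p⟩

theorem strip_infinite (f : ℕ → ℕ) : (strip f).Infinite := by
  refine Set.infinite_of_injective_forall_mem (f := fun n => Nat.pair n (f n)) ?_ ?_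
  · intro a b h
    exact (Nat.pair_eq_pair.1 h).1
  · intro n
    simp [strip]

theorem main_aux {ι : Type} [LinearOrder ι] [WellFoundedLT ι] (hι : ∀ α : ι, (Iio α).Countable)
    (hunc : ¬ (Set.univ : Set ι).Countable) :
    ∃ A : ι → Set ℕ, Function.Injective A ∧ (∀ α, (A α).Infinite) ∧
      (∀ α β, α ≠ β → (A α ∩ A β).Finite) ∧
      (∀ α m, {γ | γ < α ∧ ∀ p ∈ A γ ∩ A α, p < m}.Finite) ∧
      (∀ α, ∃ X : Set ℕ, (∀ β < α, (A β \ X).Finite) ∧ ∀ β ≥ α, (A β ∩ X).Finite) := by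
  obtain ⟨u, hu⟩ := seq_aux hι
  have hX : ∀ α, ∃ X : Set ℕ, (∀ β < α, (strip (u β) \ X).Finite) ∧
      ∀ β ≥ α, (strip (u β) ∩ X).Finite := by
    intro α
    refine ⟨{p | u α p.unpair.1 + 3 ≤ p.unpair.2}, fun β hβ => ?_, fun β hβ => ?_⟩
    · obtain ⟨N, hN⟩ := (hu α).dec β hβ 3
      refine strip_fin (u β) N _ diff_subset fun p hp => ?_
      by_contra hcon
      have h1 := hN _ (not_lt.1 hcon)
      have h2 := hp.1.1
      exact hp.2 (h1.trans h2)
    · have : ∃ N, ∀ n ≥ N, u β n ≤ u α n := by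
        rcases hβ.lt_or_eq with h | h
        · obtain ⟨N, hN⟩ := (hu β).dec α h 0
          exact ⟨N, fun n hn => by simpa using hN n hn⟩
        · exact ⟨0, fun n _ => by rw [h]⟩
      obtain ⟨N, hN⟩ := this
      refine strip_fin (u β) N _ inter_subset_left fun p hp => ?_
      by_contra hcon
      have h1 := hN _ (not_lt.1 hcon)
      have h2 := hp.1.2
      have h3 : u α p.unpair.1 + 3 ≤ p.unpair.2 := hp.2
      omega
  have had' : ∀ α β, α < β → (strip (u α) ∩ strip (u β)).Finite := by
    intro α β h
    obtain ⟨X, h1, h2⟩ := hX β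
    refine ((h1 α h).union (h2 β le_rfl)).subset fun p hp => ?_
    by_cases hp' : p ∈ X
    · exact Or.inr ⟨hp.2, hp'⟩
    · exact Or.inl ⟨hp.1, hp'⟩
  have had : ∀ α β, α ≠ β → (strip (u α) ∩ strip (u β)).Finite := by
    intro α β h
    rcases h.lt_or_gt with h | h
    · exact had' α β h
    · rw [inter_comm]
      exact had' β α h
  refine ⟨fun α => strip (u α), ?_, fun α => strip_infinite _, had, ?_, hX⟩
  · intro α β h
    by_contra hne
    have h1 := had α β hne
    simp only at h
    rw [← h, inter_self] at h1
    exact strip_infinite _ h1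
  · intro α m
    refine ((hu α).haus m).subset ?_
    rintro γ ⟨hγ, h⟩
    refine ⟨hγ, ?_⟩
    by_contra hcon
    push Not at hcon
    obtain ⟨n, hn, hn2⟩ := hcon
    obtain ⟨N, hN⟩ := (hu α).dec γ hγ 0
    have hex : ∃ k, u α (n + k) ≤ u γ (n + k) := ⟨N, by simpa using hN (n + N) (by omega)⟩
    classical
    have hs := Nat.find_spec hex
    have hmin := fun k => Nat.find_min hex (m := k)
    generalize Nat.find hex = k at hs hmin
    have key : u γ (n + k) ≤ u α (n + k) + 2 := by
      rcases k with _ | k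
      · simp only [Nat.add_zero]
        omega
      · have h1 := hmin k (by omega)
        have h2 := (hu γ).lip (n + (k + 1)) (n + k)
        have h3 := (hu α).lip (n + k) (n + (k + 1))
        omega
    have := h (Nat.pair (n + k) (u γ (n + k))) ⟨by simp [strip], by
      simp only [strip, mem_setOf_eq, Nat.unpair_pair]
      exact ⟨hs, key⟩⟩
    have h5 := Nat.left_le_pair (n + k) (u γ (n + k))
    omega

theorem bdd_aux {ι : Type} [LinearOrder ι] (hι : ∀ α : ι, (Iio α).Countable)
    (hunc : ¬ (Set.univ : Set ι).Countable) (J : Set ι) (hJ : J.Countable) :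
    ∃ α, ∀ β ∈ J, β < α := by
  by_contra hcon
  push Not at hcon
  apply hunc
  have hIic : ∀ α : ι, (Iic α).Countable := fun α => by
    rw [← Iio_insert]
    exact (hι α).insert α
  refine (hJ.biUnion fun β _ => hIic β).mono fun α _ => ?_
  obtain ⟨β, hβ, h⟩ := hcon α
  simp only [mem_iUnion]
  exact ⟨β, hβ, h⟩

/-- pigeonhole -/
theorem pigeon_aux {ι : Type} (J : Set ι) (hJ : ¬ J.Countable) (S : ι → Set ℕ)
    (hS : ∀ j ∈ J, (S j).Finite) :
    ∃ n, ¬ {j ∈ J | ∀ p ∈ S j, p ≤ n}.Countable := by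
  by_contra hcon
  push Not at hcon
  apply hJ
  refine (Set.countable_iUnion hcon).mono fun j hj => ?_
  obtain ⟨n, hn⟩ := (hS j hj).bddAbove
  simp only [mem_iUnion]
  exact ⟨n, hj, fun p hp => hn hp⟩

theorem insep_aux {ι : Type} [LinearOrder ι] (hι : ∀ α : ι, (Iio α).Countable)
    (hunc : ¬ (Set.univ : Set ι).Countable) (A : ι → Set ℕ)
    (hL : ∀ α m, {γ | γ < α ∧ ∀ p ∈ A γ ∩ A α, p < m}.Finite)
    (J K : Set ι) (hJ : ¬ J.Countable) (hK : ¬ K.Countable) (X : Set ℕ)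
    (h1 : ∀ j ∈ J, (A j \ X).Finite) (h2 : ∀ j ∈ K, (A j ∩ X).Finite) : False := by
  obtain ⟨n, hn⟩ := pigeon_aux J hJ _ h1
  obtain ⟨m, hm⟩ := pigeon_aux K hK _ h2
  have hinf : {j ∈ J | ∀ p ∈ A j \ X, p ≤ n}.Infinite := fun h => hn h.countable
  let f := hinf.natEmbedding
  obtain ⟨α₀, hα₀⟩ := bdd_aux hι hunc (Set.range fun i => (f i : ι)) (Set.countable_range _)
  have : ∃ α ∈ {j ∈ K | ∀ p ∈ A j ∩ X, p ≤ m}, α₀ ≤ α := by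
    by_contra hcon
    push Not at hcon
    exact hm ((hι α₀).mono fun α hα => hcon α hα)
  obtain ⟨α, hα, hle⟩ := this
  have hr : (Set.range fun i => (f i : ι)).Infinite :=
    Set.infinite_range_of_injective (Subtype.val_injective.comp f.injective)
  apply hr
  refine (hL α (max n m + 1)).subset ?_
  rintro _ ⟨i, rfl⟩
  refine ⟨(hα₀ _ ⟨i, rfl⟩).trans_le hle, fun p hp => ?_⟩
  have h3 := (f i).2.2 p
  have h4 := hα.2 p
  by_cases hpX : p ∈ X
  · have := h4 ⟨hp.2, hpX⟩
    have := le_max_right n m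
    omega
  · have := h3 ⟨hp.1, hpX⟩
    have := le_max_left n m
    omega

theorem sep_aux {ι : Type} [LinearOrder ι] (hι : ∀ α : ι, (Iio α).Countable)
    (hunc : ¬ (Set.univ : Set ι).Countable) (A : ι → Set ℕ)
    (had : ∀ α β, α ≠ β → (A α ∩ A β).Finite)
    (hX : ∀ α, ∃ X : Set ℕ, (∀ β < α, (A β \ X).Finite) ∧ ∀ β ≥ α, (A β ∩ X).Finite)
    (J : Set ι) (hJ : J.Countable) :
    ∃ X : Set ℕ, (∀ j ∈ J, (A j \ X).Finite) ∧ ∀ j ∉ J, (A j ∩ X).Finite := by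
  obtain ⟨α, hα⟩ := bdd_aux hι hunc J hJ
  obtain ⟨X, hX1, hX2⟩ := hX α
  obtain ⟨c, hc⟩ := (Set.countable_iff_exists_injOn).1 (hι α)
  have hfin : ∀ n, {γ | γ < α ∧ c γ ≤ n}.Finite := by
    intro n
    refine Set.Finite.of_finite_image (f := c) ((Set.finite_Iic n).subset ?_)
      (hc.mono fun γ h => h.1)
    rintro _ ⟨γ, h, rfl⟩
    exact h.2
  refine ⟨X ∩ {p | ∃ β ∈ J, p ∈ A β ∧ ∀ γ < α, γ ∉ J → c γ ≤ c β → p ∉ A γ}, ?_, ?_⟩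
  · intro β hβ
    have hF : (⋃ γ ∈ {γ | γ < α ∧ c γ ≤ c β} \ J, A β ∩ A γ).Finite :=
      ((hfin (c β)).subset diff_subset).biUnion fun γ hγ =>
        had β γ fun h => hγ.2 (h ▸ hβ)
    refine ((hX1 β (hα β hβ)).union hF).subset ?_
    rintro p ⟨hp1, hp2⟩
    by_contra hcon
    simp only [mem_union, not_or, mem_iUnion, not_exists] at hcon
    apply hp2
    refine ⟨by_contra fun h => hcon.1 ⟨hp1, h⟩, β, hβ, hp1, fun γ hγ hγJ hle hpγ => ?_⟩
    exact hcon.2 γ ⟨⟨hγ, hle⟩, hγJ⟩ ⟨hp1, hpγ⟩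
  · intro γ hγ
    by_cases hlt : γ < α
    · have hF : (⋃ β ∈ {β | β < α ∧ c β ≤ c γ} ∩ J, A γ ∩ A β).Finite :=
        ((hfin (c γ)).subset inter_subset_left).biUnion fun β hβ =>
          had γ β fun h => hγ (h ▸ hβ.2)
      refine hF.subset ?_
      rintro p ⟨hp, _, β, hβ, hpβ, h⟩
      simp only [mem_iUnion]
      refine ⟨β, ⟨⟨hα β hβ, ?_⟩, hβ⟩, hp, hpβ⟩
      by_contra hcon
      exact h γ hlt hγ (by omega) hp
    · exact (hX2 γ (not_lt.1 hlt)).subset fun p hp => ⟨hp.1, hp.2.1⟩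

theorem exists_inseparable_family_with_all_countable_separations :
    ∃ 𝒜 : Set (Set ℕ), IsAlmostDisjointFamily 𝒜 ∧
      Cardinal.mk ↥𝒜 = Cardinal.aleph 1 ∧
      (∀ ℬ 𝒞 : Set (Set ℕ), ℬ ⊆ 𝒜 → 𝒞 ⊆ 𝒜 → Disjoint ℬ 𝒞 →
        ¬ ℬ.Countable → ¬ 𝒞.Countable → ¬ SeparatedFamilies ℬ 𝒞) ∧
      (∀ ℬ : Set (Set ℕ), ℬ ⊆ 𝒜 → ℬ.Countable → SeparatedFamilies ℬ (𝒜 \ ℬ)) := by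
  let ι : Type := (Cardinal.aleph 1).ord.ToType
  have hmk : Cardinal.mk ι = Cardinal.aleph 1 := Cardinal.mk_ord_toType _
  have hι : ∀ α : ι, (Iio α).Countable := by
    intro α
    have h := Cardinal.mk_Iio_toType_ord_lt α
    rw [← Cardinal.le_aleph0_iff_set_countable, ← Order.lt_succ_iff, Cardinal.succ_aleph0]
    exact h
  have hunc : ¬ (Set.univ : Set ι).Countable := by
    rw [← Cardinal.le_aleph0_iff_set_countable, Cardinal.mk_univ, hmk, not_le]
    exact Cardinal.aleph0_lt_aleph_one
  obtain ⟨A, hinj, hinf, had, hL, hX⟩ := main_aux hι hunc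
  refine ⟨Set.range A, ⟨?_, ?_, ?_⟩, ?_, ?_, ?_⟩
  · refine Set.infinite_range_iff hinj |>.2 ?_
    rw [← Set.infinite_univ_iff]
    exact fun h => hunc h.countable
  · rintro _ ⟨α, rfl⟩
    exact hinf α
  · rintro _ ⟨α, rfl⟩ _ ⟨β, rfl⟩ h
    exact had α β fun h' => h (by rw [h'])
  · rw [Cardinal.mk_range_eq A hinj, hmk]
  · rintro ℬ 𝒞 hB hC - hBc hCc ⟨X, h1, h2⟩
    have key : ∀ 𝒟 : Set (Set ℕ), 𝒟 ⊆ Set.range A → ¬ 𝒟.Countable → ¬ (A ⁻¹' 𝒟).Countable := by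
      intro 𝒟 hD hDc h
      apply hDc
      have := h.image A
      rwa [Set.image_preimage_eq_of_subset hD] at this
    exact insep_aux hι hunc A hL (A ⁻¹' ℬ) (A ⁻¹' 𝒞) (key _ hB hBc) (key _ hC hCc) X
      (fun j hj => h1 _ hj) (fun j hj => h2 _ hj)
  · intro ℬ hB hBc
    obtain ⟨X, h1, h2⟩ := sep_aux hι hunc A had hX (A ⁻¹' ℬ) (hBc.preimage hinj)
    refine ⟨X, ?_, ?_⟩
    · intro B hBB
      obtain ⟨j, rfl⟩ := hB hBB
      exact h1 j hBB
    · rintro _ ⟨⟨j, rfl⟩, hj⟩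
      exact h2 j hj
end

section
/- There exists an inseparable almost disjoint family (X_α)_{α<ω₁} of infinite subsets of ℕ (with X_α ≠ X_β for α ≠ β) such that for every set 𝒳 ⊆ ω₁ with both 𝒳 and ω₁ \ 𝒳 uncountable, there exist families (A_α)_{α<ω₁} and (B_α)_{α<ω₁} of subsets of ℕ with: (a) A_α ∩ B_α = ∅ for every α < ω₁; (b) A_α \ A_β and B_α \ B_β are finite for all α < β < ω₁; (c) for all β < α < ω₁, if β ∈ 𝒳 then X_β \ A_α is finite, and if β ∉ 𝒳 then X_β \ B_α is finite; (d) (A_α, B_α)_{α<ω₁} is a gap, i.e., there is no C ⊆ ℕ such that A_α \ C is finite and C ∩ B_α is finite for every α < ω₁. -/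
open Set

namespace LuzinGap

open scoped ENNReal

noncomputable def term (c d : ℝ≥0∞) (F : Finset ℕ) (n : ℕ) (S : Set ℕ) : ℝ≥0∞ :=
  (c ^ {x | x ∈ F ∧ x < n ∧ x ∈ S}.ncard + c ^ {x | x ∈ F ∧ x < n ∧ x ∉ S}.ncard) *
    d ^ {x | x ∈ F ∧ n ≤ x}.ncard

theorem term_step (c d : ℝ≥0∞) (hd : 1 + c = 2 * d) (F : Finset ℕ) (n : ℕ) (S : Set ℕ) :
    term c d F (n+1) (insert n S) + term c d F (n+1) (S \ {n}) = 2 * term c d F n S := by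
  unfold term
  have hfin : ∀ P : ℕ → Prop, {x | x ∈ F ∧ P x}.Finite := fun P =>
    F.finite_toSet.subset (fun x hx => hx.1)
  have h2 : {x | x ∈ F ∧ x < n + 1 ∧ x ∉ insert n S} = {x | x ∈ F ∧ x < n ∧ x ∉ S} := by
    ext x
    simp only [Set.mem_ofPred_eq, Set.mem_insert_iff]
    grind
  have h3 : {x | x ∈ F ∧ x < n + 1 ∧ x ∈ S \ {n}} = {x | x ∈ F ∧ x < n ∧ x ∈ S} := by
    ext x
    simp only [Set.mem_ofPred_eq, Set.mem_sdiff, Set.mem_singleton_iff]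
    grind
  by_cases hn : n ∈ F
  · have h1 : {x | x ∈ F ∧ x < n + 1 ∧ x ∈ insert n S}
        = insert n {x | x ∈ F ∧ x < n ∧ x ∈ S} := by
      ext x
      simp only [Set.mem_ofPred_eq, Set.mem_insert_iff]
      grind
    have h4 : {x | x ∈ F ∧ x < n + 1 ∧ x ∉ S \ {n}}
        = insert n {x | x ∈ F ∧ x < n ∧ x ∉ S} := by
      ext x
      simp only [Set.mem_ofPred_eq, Set.mem_insert_iff, Set.mem_sdiff, Set.mem_singleton_iff]
      grind
    have h5 : {x | x ∈ F ∧ n ≤ x} = insert n {x | x ∈ F ∧ n + 1 ≤ x} := by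
      ext x
      simp only [Set.mem_ofPred_eq, Set.mem_insert_iff]
      grind
    rw [h1, h2, h3, h4, h5, Set.ncard_insert_of_notMem (by simp) (hfin _),
      Set.ncard_insert_of_notMem (by simp) (hfin _), Set.ncard_insert_of_notMem (by simp) (hfin _)]
    set A := {x | x ∈ F ∧ x < n ∧ x ∈ S}.ncard
    set B := {x | x ∈ F ∧ x < n ∧ x ∉ S}.ncard
    set E := {x | x ∈ F ∧ n + 1 ≤ x}.ncard
    calc _ = (c^A + c^B) * (1 + c) * d^E := by ring
      _ = _ := by rw [hd]; ring
  · have h1 : {x | x ∈ F ∧ x < n + 1 ∧ x ∈ insert n S} = {x | x ∈ F ∧ x < n ∧ x ∈ S} := by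
      ext x
      simp only [Set.mem_ofPred_eq, Set.mem_insert_iff]
      grind
    have h4 : {x | x ∈ F ∧ x < n + 1 ∧ x ∉ S \ {n}} = {x | x ∈ F ∧ x < n ∧ x ∉ S} := by
      ext x
      simp only [Set.mem_ofPred_eq, Set.mem_sdiff, Set.mem_singleton_iff]
      grind
    have h5 : {x | x ∈ F ∧ n ≤ x} = {x | x ∈ F ∧ n + 1 ≤ x} := by
      ext x
      simp only [Set.mem_ofPred_eq]
      grind
    rw [h1, h2, h3, h4, h5]
    ring

theorem split_greedy {ι : Type*} (a c d : ι → ℝ≥0∞) (F : ι → Finset ℕ)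
    (hd : ∀ p, 1 + c p = 2 * d p) :
    ∃ D : Set ℕ, ∑' p, a p * (c p ^ ((F p : Set ℕ) ∩ D).ncard + c p ^ ((F p : Set ℕ) \ D).ncard)
      ≤ 2 * ∑' p, a p * d p ^ (F p).card := by
  classical
  set Φ : ℕ → Set ℕ → ℝ≥0∞ := fun n S => ∑' p, a p * term (c p) (d p) (F p) n S with hΦ
  have step : ∀ n S, ∃ S' : Set ℕ, (∀ x < n, x ∈ S' ↔ x ∈ S) ∧ Φ (n+1) S' ≤ Φ n S := by
    intro n S
    have h : Φ (n+1) (insert n S) + Φ (n+1) (S \ {n}) = Φ n S + Φ n S := by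
      rw [← two_mul]
      simp only [hΦ]
      rw [← ENNReal.tsum_add, ← ENNReal.tsum_mul_left]
      congr 1; ext p
      rw [← mul_add, term_step _ _ (hd p)]; ring
    by_cases h1 : Φ (n+1) (insert n S) ≤ Φ n S
    · exact ⟨_, fun x hx => by simp [hx.ne], h1⟩
    · by_cases h2 : Φ (n+1) (S \ {n}) ≤ Φ n S
      · exact ⟨_, fun x hx => by simp [hx.ne], h2⟩
      · push Not at h1 h2
        exact absurd h (ENNReal.add_lt_add h1 h2).ne'
  choose g hg1 hg2 using step
  let S : ℕ → Set ℕ := fun n => Nat.rec ∅ (fun n S => g n S) n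
  have hS : ∀ n, S (n+1) = g n (S n) := fun n => rfl
  have hle : ∀ n, Φ n (S n) ≤ Φ 0 ∅ := by
    intro n
    induction n with
    | zero => exact le_rfl
    | succ n ih => rw [hS]; exact (hg2 _ _).trans ih
  let D : Set ℕ := {x | x ∈ S (x+1)}
  have hD : ∀ n, ∀ x < n, x ∈ S n ↔ x ∈ D := by
    intro n
    induction n with
    | zero => intro x hx; omega
    | succ n ih =>
      intro x hx
      rcases Nat.lt_succ_iff_lt_or_eq.1 hx with h | h
      · rw [hS, hg1 _ _ _ h, ih x h]
      · subst h; rfl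
  have h0 : Φ 0 ∅ = 2 * ∑' p, a p * d p ^ (F p).card := by
    simp only [hΦ, term]
    rw [← ENNReal.tsum_mul_left]
    congr 1; ext p
    simp; ring
  refine ⟨D, ?_⟩
  rw [← h0]
  rw [ENNReal.tsum_eq_iSup_sum]
  refine iSup_le fun P => ?_
  obtain ⟨n, hn⟩ : ∃ n, ∀ p ∈ P, ∀ x ∈ F p, x < n := by
    refine ⟨(P.biUnion F).sup id + 1, fun p hp x hx => Nat.lt_succ_of_le ?_⟩
    exact Finset.le_sup (f := id) (Finset.mem_biUnion.2 ⟨p, hp, hx⟩)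
  refine le_trans ?_ (hle n)
  refine le_trans (Finset.sum_le_sum ?_) (ENNReal.sum_le_tsum P)
  intro p hp
  gcongr
  unfold term
  have e1 : ((F p : Set ℕ) ∩ D) = {x | x ∈ F p ∧ x < n ∧ x ∈ S n} := by
    ext x
    have := hn p hp x
    have := hD n x
    simp only [Set.mem_inter_iff, Finset.mem_coe, Set.mem_ofPred_eq]; grind
  have e2 : ((F p : Set ℕ) \ D) = {x | x ∈ F p ∧ x < n ∧ x ∉ S n} := by
    ext x
    have := hn p hp x
    have := hD n x
    simp only [Set.mem_sdiff, Finset.mem_coe, Set.mem_ofPred_eq]; grind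
  have e3 : {x | x ∈ F p ∧ n ≤ x} = ∅ := by
    ext x
    have := hn p hp x
    simp only [Set.mem_ofPred_eq, Set.mem_empty_iff_false]; grind
  rw [e1, e2, e3]
  simp

noncomputable def cc : ℕ → ℝ≥0∞
  | 0 => 2⁻¹
  | (k+1) => 2⁻¹ * (1 + cc k)

theorem cc_succ (k : ℕ) : 1 + cc k = 2 * cc (k+1) := by
  rw [cc, ← mul_assoc, ENNReal.mul_inv_cancel (by simp) (by simp), one_mul]

theorem cc_lt_one (k : ℕ) : cc k < 1 := by
  induction k with
  | zero => simp [cc]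
  | succ k ih =>
    rw [cc]
    calc 2⁻¹ * (1 + cc k) < 2⁻¹ * (1 + 1) := by
          rw [ENNReal.mul_lt_mul_iff_right (by simp) (by simp)]
          exact ENNReal.add_lt_add_left (by simp) ih
      _ = 1 := by rw [one_add_one_eq_two, ENNReal.inv_mul_cancel (by simp) (by simp)]

theorem cc_ne_zero (k : ℕ) : cc k ≠ 0 := by
  cases k <;> simp [cc]

theorem cc_le_succ (k : ℕ) : cc k ≤ cc (k+1) := by
  calc cc k = 2⁻¹ * (cc k + cc k) := by
        rw [← two_mul, ← mul_assoc, ENNReal.inv_mul_cancel (by simp) (by simp), one_mul]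
    _ ≤ _ := by rw [cc]; gcongr; exact (cc_lt_one k).le

theorem cc_mono : Monotone cc := monotone_nat_of_le_succ cc_le_succ

noncomputable def q (k : ℕ) (S : Set ℕ) : ℝ≥0∞ := by
  classical exact if S.Finite then cc k ^ S.ncard else 0

theorem q_fin {k : ℕ} {S : Set ℕ} (h : S.Finite) : q k S = cc k ^ S.ncard := by
  simp [q, h]

theorem q_inf {k : ℕ} {S : Set ℕ} (h : S.Infinite) : q k S = 0 := by
  have : ¬ S.Finite := h
  simp [q, this]

theorem q_le_one (k : ℕ) (S : Set ℕ) : q k S ≤ 1 := by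
  unfold q; split_ifs
  · exact pow_le_one' (cc_lt_one k).le _
  · simp

theorem q_anti {k : ℕ} {S S' : Set ℕ} (h : S ⊆ S') : q k S' ≤ q k S := by
  by_cases h' : S'.Finite
  · rw [q_fin h', q_fin (h'.subset h)]
    exact pow_le_pow_right_of_le_one' (cc_lt_one k).le (Set.ncard_le_ncard h h')
  · rw [q_inf h']; simp

theorem q_mono {k l : ℕ} (h : k ≤ l) (S : Set ℕ) : q k S ≤ q l S := by
  by_cases h' : S.Finite
  · rw [q_fin h', q_fin h']
    exact pow_le_pow_left' (cc_mono h) _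
  · rw [q_inf h']; simp

theorem q_almost (k : ℕ) {V W : Set ℕ} (h : (V \ W).Finite) (S : Set ℕ) :
    q k (S ∩ W) ≤ (cc k ^ (V \ W).ncard)⁻¹ * q k (S ∩ V) := by
  by_cases h' : (S ∩ W).Finite
  · have hsub : S ∩ V ⊆ (S ∩ W) ∪ (V \ W) := by intro x; simp; tauto
    have hfin : (S ∩ V).Finite := (h'.union h).subset hsub
    rw [q_fin h', q_fin hfin]
    have hc : (S ∩ V).ncard ≤ (S ∩ W).ncard + (V \ W).ncard :=
      (Set.ncard_le_ncard hsub (h'.union h)).trans (Set.ncard_union_le _ _)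
    have h1 : cc k ^ (V \ W).ncard * cc k ^ (S ∩ W).ncard ≤ cc k ^ (S ∩ V).ncard := by
      rw [← pow_add]
      exact pow_le_pow_right_of_le_one' (cc_lt_one k).le (by omega)
    have h0 : cc k ^ (V \ W).ncard ≠ 0 := pow_ne_zero _ (cc_ne_zero k)
    have ht : cc k ^ (V \ W).ncard ≠ ⊤ := ENNReal.pow_ne_top ((cc_lt_one k).trans (by simp)).ne
    calc cc k ^ (S ∩ W).ncard
        = (cc k ^ (V \ W).ncard)⁻¹ * (cc k ^ (V \ W).ncard * cc k ^ (S ∩ W).ncard) := by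
          rw [← mul_assoc, ENNReal.inv_mul_cancel h0 ht, one_mul]
      _ ≤ _ := by gcongr
  · rw [q_inf h']; simp

theorem q_approx (k : ℕ) (S : Set ℕ) {ε : ℝ≥0∞} (hε : ε ≠ 0) :
    ∃ F ⊆ S, F.Finite ∧ q k F ≤ q k S + ε := by
  by_cases h : S.Finite
  · exact ⟨S, le_rfl, h, le_self_add⟩
  · have ht := ENNReal.tendsto_pow_atTop_nhds_zero_of_lt_one (cc_lt_one k)
    obtain ⟨n, hn⟩ := ((tendsto_order.1 ht).2 ε (pos_iff_ne_zero.2 hε)).exists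
    obtain ⟨F, hF, hFf, hc⟩ := Set.Infinite.exists_subset_ncard_eq h n
    refine ⟨F, hF, hFf, ?_⟩
    rw [q_fin hFf, hc]
    exact hn.le.trans le_add_self

theorem split_q {ι : Type*} (F : ι → Set ℕ) (hF : ∀ i, (F i).Finite)
    (h : ∀ k, ∑' i, q k (F i) ≠ ⊤) :
    ∃ D : Set ℕ, ∀ k, ∑' i, q k (F i ∩ D) ≠ ⊤ ∧ ∑' i, q k (F i \ D) ≠ ⊤ := by
  obtain ⟨ε, hε, hs⟩ := ENNReal.exists_pos_tsum_mul_lt_of_countable (ε := 1) (by simp)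
    (fun k => ∑' i, q (k+1) (F i)) (fun k => h (k+1))
  obtain ⟨D, hD⟩ := split_greedy (ι := ℕ × ι) (fun p => (ε p.1 : ℝ≥0∞)) (fun p => cc p.1)
    (fun p => cc (p.1+1)) (fun p => (hF p.2).toFinset) (fun p => cc_succ _)
  have hfin : 2 * ∑' p : ℕ × ι, (ε p.1 : ℝ≥0∞) * cc (p.1+1) ^ ((hF p.2).toFinset).card ≠ ⊤ := by
    apply ENNReal.mul_ne_top (by simp)
    rw [ENNReal.tsum_prod (f := fun k i => (ε k : ℝ≥0∞) * cc (k+1) ^ ((hF i).toFinset).card)]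
    refine ne_of_lt (lt_of_le_of_lt (le_of_eq ?_) (hs.trans (by simp)))
    congr 1; ext k
    rw [ENNReal.tsum_mul_left, mul_comm]
    simp_rw [q_fin (hF _), Set.ncard_eq_toFinset_card _ (hF _)]
  have hfin2 := ne_top_of_le_ne_top hfin hD
  rw [ENNReal.tsum_prod (f := fun k i => (ε k : ℝ≥0∞) * (cc k ^ (((hF i).toFinset : Set ℕ) ∩ D).ncard
    + cc k ^ (((hF i).toFinset : Set ℕ) \ D).ncard))] at hfin2
  refine ⟨D, fun k => ?_⟩
  have hk := ne_top_of_le_ne_top hfin2 (ENNReal.le_tsum k)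
  simp only [Set.Finite.coe_toFinset] at hk
  rw [ENNReal.tsum_mul_left, ENNReal.tsum_add] at hk
  have hk2 : ∑' a, cc k ^ (F a ∩ D).ncard + ∑' a, cc k ^ (F a \ D).ncard ≠ ⊤ := by
    intro h
    rw [h, ENNReal.mul_top (by simpa using (hε k).ne')] at hk
    exact hk rfl
  rw [ENNReal.add_ne_top] at hk2
  simp_rw [q_fin ((hF _).inter_of_left _), q_fin ((hF _).sdiff)]
  exact hk2

theorem split_inf {ι : Type*} (F : ι → Set ℕ) (hF : ∀ i, (F i).Finite)
    (h : ∀ k, ∑' i, q k (F i) ≠ ⊤) (U : Set ℕ) (hU : U.Infinite) :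
    ∃ D : Set ℕ, (U ∩ D).Infinite ∧ (U \ D).Infinite ∧
      ∀ k, ∑' i, q k (F i ∩ D) ≠ ⊤ ∧ ∑' i, q k (F i \ D) ≠ ⊤ := by
  have hQ := fun m => Set.Infinite.exists_subset_ncard_eq hU m
  choose Q hQU hQf hQc using hQ
  obtain ⟨D, hD⟩ := split_q (ι := ι ⊕ ℕ) (Sum.elim F Q)
    (by rintro (i | m); exacts [hF i, hQf m]) (by
      intro k
      rw [Summable.tsum_sum ENNReal.summable ENNReal.summable]
      refine ENNReal.add_ne_top.2 ⟨h k, ?_⟩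
      simp only [Sum.elim_inr, q_fin (hQf _), hQc]
      rw [ENNReal.tsum_geometric]
      simpa [tsub_eq_zero_iff_le] using cc_lt_one k)
  have key : ∀ E : Set ℕ, ∑' m, q 0 (Q m ∩ E) ≠ ⊤ → (U ∩ E).Infinite := by
    intro E hE hfin
    apply hE
    have h1 : ∑' m : ℕ, q 0 (U ∩ E) = ⊤ := by
      apply ENNReal.tsum_const_eq_top_of_ne_zero
      rw [q_fin hfin]
      exact pow_ne_zero _ (cc_ne_zero 0)
    rw [eq_top_iff, ← h1]
    exact ENNReal.tsum_le_tsum fun m => q_anti (Set.inter_subset_inter_left _ (hQU m))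
  have hD' : ∀ k, (∑' i, q k (F i ∩ D) ≠ ⊤ ∧ ∑' m, q k (Q m ∩ D) ≠ ⊤) ∧
      (∑' i, q k (F i \ D) ≠ ⊤ ∧ ∑' m, q k (Q m \ D) ≠ ⊤) := by
    intro k
    have := hD k
    rw [Summable.tsum_sum ENNReal.summable ENNReal.summable,
      Summable.tsum_sum ENNReal.summable ENNReal.summable, ENNReal.add_ne_top,
      ENNReal.add_ne_top] at this
    exact this
  exact ⟨D, key D (hD' 0).1.2, key Dᶜ (hD' 0).2.2, fun k => ⟨(hD' k).1.1, (hD' k).2.1⟩⟩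


/-- A pseudo-intersection which stays large with respect to all `X i`. -/
theorem pseudo_inter {I : Type*} [Countable I] (X : I → Set ℕ) (e : I → ℕ)
    (he : Function.Injective e) (W : ℕ → Set ℕ) (hanti : Antitone W)
    (hinf : ∀ j, (W j).Infinite) (hgood : ∀ j k, ∑' i, q k (X i ∩ W j) ≠ ⊤) :
    ∃ U : Set ℕ, U.Infinite ∧ (∀ j, (U \ W j).Finite) ∧ ∀ k, ∑' i, q k (X i ∩ U) ≠ ⊤ := by
  classical
  obtain ⟨δ, hδ, hδs⟩ := ENNReal.exists_pos_sum_of_countable' (ε := 1) (by simp) ℕ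
  obtain ⟨η, hη, hηs⟩ := ENNReal.exists_pos_sum_of_countable' (ε := 1) (by simp) I
  have hE : ∀ j, ∃ E : Finset I, ∑' i : {x // x ∉ E}, q j (X i ∩ W j) < δ j := by
    intro j
    exact ((tendsto_order.1 (ENNReal.tendsto_tsum_compl_atTop_zero (hgood j j))).2 _ (hδ j)).exists
  choose E hE using hE
  let s : I → ℝ≥0∞ := fun i => ∑' j, if i ∈ E j then 0 else q j (X i ∩ W j)
  have hs : ∑' i, s i < 1 := by
    simp only [s]
    rw [ENNReal.tsum_comm]
    refine lt_of_le_of_lt (ENNReal.tsum_le_tsum fun j => ?_) hδs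
    refine le_trans (le_of_eq ?_) (hE j).le
    rw [show (∑' i : {x // x ∉ E j}, q j (X i ∩ W j)) =
      ∑' i : ({x | x ∉ E j} : Set I), q j (X i ∩ W j) from rfl,
      tsum_subtype ({x | x ∉ E j} : Set I) (fun i => q j (X i ∩ W j))]
    congr 1; ext i
    by_cases h : i ∈ E j <;> simp [h]
  -- the level of an index
  have hJ : ∀ i, ∃ J : ℕ, (∀ j, j ≤ e i → i ∉ E j → j ≤ J) ∧ (i ∉ E 0 → i ∉ E J) := by
    intro i
    refine ⟨Nat.findGreatest (fun j => i ∉ E j) (e i), fun j hj h => ?_, fun h => ?_⟩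
    · exact Nat.le_findGreatest hj h
    · exact Nat.findGreatest_spec (P := fun j => i ∉ E j) (Nat.zero_le _) h
  choose J hJ1 hJ2 using hJ
  have hJfin : ∀ j0, {i | J i < j0}.Finite := by
    intro j0
    have h1 : {i | e i < j0}.Finite := (Set.finite_Iio j0).preimage he.injOn
    refine (h1.union (E j0).finite_toSet).subset ?_
    intro i hi
    by_contra hcon
    simp only [Set.mem_union, Set.mem_ofPred_eq, Finset.mem_coe, not_or, not_lt] at hcon hi
    exact absurd (hJ1 i j0 hcon.1 hcon.2) (by omega)
  have hF : ∀ i, ∃ F ⊆ X i ∩ W (J i), F.Finite ∧ q (J i) F ≤ q (J i) (X i ∩ W (J i)) + η i :=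
    fun i => q_approx _ _ (hη i).ne'
  choose F hFsub hFfin hFq using hF
  have hu : ∀ j, ∃ u ∈ W j, j < u := fun j => (hinf j).exists_gt j
  choose u huW hu using hu
  refine ⟨(⋃ i, F i) ∪ Set.range u, ?_, ?_, ?_⟩
  · apply Set.Infinite.mono (Set.subset_union_right)
    apply Set.infinite_of_forall_exists_gt
    intro a
    exact ⟨u a, ⟨a, rfl⟩, hu a⟩
  · intro j
    have h1 : (⋃ i ∈ {i | J i < j}, F i).Finite := (hJfin j).biUnion (fun i _ => hFfin i)
    have h2 : (u '' Set.Iio j).Finite := (Set.finite_Iio j).image u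
    refine (h1.union h2).subset ?_
    rintro x ⟨hx | ⟨m, rfl⟩, hxW⟩
    · obtain ⟨i, hi⟩ := Set.mem_iUnion.1 hx
      left
      refine Set.mem_biUnion (x := i) ?_ hi
      by_contra hcon
      exact hxW (hanti (not_lt.1 hcon) (hFsub i hi).2)
    · right
      refine ⟨m, ?_, rfl⟩
      by_contra hcon
      exact hxW (hanti (not_lt.1 hcon) (huW m))
  · intro k
    have hB : ({i | J i < k} ∪ (E 0 : Set I)).Finite := (hJfin k).union (E 0).finite_toSet
    have hle : ∀ i, q k (X i ∩ ((⋃ i, F i) ∪ Set.range u)) ≤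
        (if i ∈ hB.toFinset then 1 else 0) + (s i + η i) := by
      intro i
      by_cases hi : i ∈ hB.toFinset
      · rw [if_pos hi]
        exact (q_le_one _ _).trans le_self_add
      · rw [if_neg hi, zero_add]
        simp only [Set.Finite.mem_toFinset, Set.mem_union, Set.mem_ofPred_eq, Finset.mem_coe,
          not_or, not_lt] at hi
        calc q k (X i ∩ ((⋃ i, F i) ∪ Set.range u)) ≤ q k (F i) := by
              apply q_anti
              intro x hx
              exact ⟨(hFsub i hx).1, Or.inl (Set.mem_iUnion.2 ⟨i, hx⟩)⟩
          _ ≤ q (J i) (F i) := q_mono hi.1 _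
          _ ≤ _ := hFq i
          _ ≤ s i + η i := by
            gcongr
            refine le_trans ?_ (ENNReal.le_tsum (J i))
            rw [if_neg (hJ2 i hi.2)]
    refine ne_top_of_le_ne_top ?_ (ENNReal.tsum_le_tsum hle)
    rw [ENNReal.tsum_add, ENNReal.tsum_add]
    refine ENNReal.add_ne_top.2 ⟨?_, ENNReal.add_ne_top.2 ⟨hs.ne_top, hηs.ne_top⟩⟩
    rw [tsum_eq_sum (s := hB.toFinset) (fun b hb => if_neg hb)]
    simp

/-- One step of the recursion. -/
theorem step {I : Type*} [LinearOrder I] [Countable I] (X V : I → Set ℕ)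
    (hX : ∀ i, (X i).Infinite) (hV : ∀ i, (V i).Infinite)
    (hlt : ∀ i j, i < j → ((X j ∪ V j) \ V i).Finite)
    (hdisj : ∀ i, Disjoint (X i) (V i))
    (hgood : ∀ i k, ∑' j : Set.Iio i, q k (X j ∩ V i) ≠ ⊤) :
    ∃ Y W : Set ℕ, Y.Infinite ∧ W.Infinite ∧ Disjoint Y W ∧ (∀ i, ((Y ∪ W) \ V i).Finite) ∧
      (∀ k, ∑' i, q k (X i ∩ Y) ≠ ⊤) ∧ (∀ k, ∑' i, q k (X i ∩ W) ≠ ⊤) := by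
  classical
  obtain ⟨e, he⟩ := Countable.exists_injective_nat I
  let W : ℕ → Set ℕ := fun j => {x | ∀ i, e i ≤ j → x ∈ V i}
  have hfin : ∀ j, {i | e i ≤ j}.Finite := fun j => (Set.finite_Iic j).preimage he.injOn
  have hcases : ∀ j, W j = Set.univ ∨ ∃ g, e g ≤ j ∧ (∀ i, e i ≤ j → i ≤ g) := by
    intro j
    by_cases hne : {i | e i ≤ j}.Nonempty
    · right
      obtain ⟨g, hg, hmax⟩ := Set.exists_max_image _ id (hfin j) hne
      exact ⟨g, hg, fun i hi => hmax i hi⟩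
    · left
      ext x
      simp only [W, Set.mem_ofPred_eq, Set.mem_univ, iff_true]
      intro i hi
      exact absurd ⟨i, hi⟩ hne
  have hVW : ∀ j (S : Set ℕ), (∀ i, e i ≤ j → (S \ V i).Finite) → (S \ W j).Finite := by
    intro j S h
    refine ((hfin j).biUnion (t := fun i => S \ V i) (fun i hi => h i hi)).subset ?_
    rintro x ⟨hx, hxW⟩
    simp only [W, Set.mem_ofPred_eq, not_forall] at hxW
    obtain ⟨i, hi, hxi⟩ := hxW
    exact Set.mem_biUnion (x := i) hi ⟨hx, hxi⟩
  have hinfW : ∀ j (S : Set ℕ), S.Infinite → (S \ W j).Finite → (S ∩ W j).Infinite := by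
    intro j S hS h hf
    apply hS
    rw [← Set.inter_union_sdiff S (W j)]
    exact hf.union h
  have hVg : ∀ j g, e g ≤ j → (∀ i, e i ≤ j → i ≤ g) → (V g \ W j).Finite := by
    intro j g hg hmax
    apply hVW
    intro i hi
    rcases (hmax i hi).eq_or_lt with h | h
    · subst h; simp
    · exact (hlt i g h).subset (fun x hx => ⟨Or.inr hx.1, hx.2⟩)
  obtain ⟨U, hUinf, hUW, hUgood⟩ := pseudo_inter X e he W
    (fun a b hab x hx i hi => hx i (hi.trans hab))
    (by
      intro j
      rcases hcases j with h | ⟨g, hg, hmax⟩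
      · rw [h]; exact Set.infinite_univ
      · exact (hinfW j _ (hV g) (hVg j g hg hmax)).mono Set.inter_subset_right)
    (by
      intro j k
      rcases hcases j with h | ⟨g, hg, hmax⟩
      · rw [h]
        simp [q_inf (hX _)]
      · have hle : ∀ i, q k (X i ∩ W j) ≤ (if i = g then 1 else 0) +
            (Set.Iio g).indicator (fun i => (cc k ^ (V g \ W j).ncard)⁻¹ * q k (X i ∩ V g)) i := by
          intro i
          rcases lt_trichotomy i g with h | h | h
          · rw [Set.indicator_of_mem (show i ∈ Set.Iio g from h)]
            exact (q_almost k (hVg j g hg hmax) _).trans le_add_self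
          · rw [if_pos h]
            exact (q_le_one _ _).trans le_self_add
          · rw [q_inf]
            · simp
            · apply hinfW _ _ (hX i)
              apply hVW
              intro i' hi'
              exact (hlt i' i ((hmax i' hi').trans_lt h)).subset (fun x hx => ⟨Or.inl hx.1, hx.2⟩)
        refine ne_top_of_le_ne_top ?_ (ENNReal.tsum_le_tsum hle)
        rw [ENNReal.tsum_add, ← tsum_subtype, ENNReal.tsum_mul_left]
        refine ENNReal.add_ne_top.2 ⟨?_, ENNReal.mul_ne_top ?_ (hgood g k)⟩
        · simp
        · rw [ENNReal.inv_ne_top]; exact pow_ne_zero _ (cc_ne_zero k))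
  have hUV : ∀ i, (U \ V i).Finite := by
    intro i
    refine (hUW (e i)).subset ?_
    rintro x ⟨hx, hxV⟩
    exact ⟨hx, fun h => hxV (h i le_rfl)⟩
  obtain ⟨D, h1, h2, h3⟩ := split_inf (fun i => X i ∩ U) (fun i => by
    refine (hUV i).subset ?_
    rintro x ⟨hx, hxU⟩
    exact ⟨hxU, fun h => Set.disjoint_left.1 (hdisj i) hx h⟩) hUgood U hUinf
  refine ⟨U ∩ D, U \ D, h1, h2, ?_, ?_, ?_, ?_⟩
  · exact Set.disjoint_left.2 (fun x hx hx' => hx'.2 hx.2)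
  · intro i
    rw [Set.inter_union_sdiff]
    exact hUV i
  · intro k
    have := (h3 k).1
    simpa only [Set.inter_assoc] using this
  · intro k
    have := (h3 k).2
    simpa only [Set.inter_sdiff_assoc] using this

/-- Transfinite recursion with an invariant. -/
theorem rec_exists {Y : Type*} [Nonempty Y] (o : Ordinal)
    (P : (a : Ordinal) → (Set.Iio a → Y) → Y → Prop)
    (h : ∀ a < o, ∀ f : Ordinal → Y, (∀ b < a, P b (fun x => f x) (f b)) →
      ∃ y, P a (fun x => f x) y) :
    ∃ f : Ordinal → Y, ∀ a < o, P a (fun x => f x) (f a) := by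
  classical
  let G : (a : Ordinal) → ((b : Ordinal) → b < a → Y) → Y := fun a g =>
    Classical.epsilon (fun y => P a (fun x => g x.1 x.2) y)
  let f : Ordinal → Y := Ordinal.lt_wf.fix G
  have hf : ∀ a, f a = Classical.epsilon (fun y => P a (fun x => f x.1) y) := by
    intro a
    exact Ordinal.lt_wf.fix_eq G a
  refine ⟨f, fun a => ?_⟩
  induction a using WellFoundedLT.induction with
  | _ a ih =>
    intro ha
    rw [hf a]
    exact Classical.epsilon_spec (h a ha f (fun b hb => ih b hb (hb.trans ha)))

theorem countable_Iio {a : Ordinal} (ha : a < omega1) : (Set.Iio a).Countable := by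
  rw [← Cardinal.le_aleph0_iff_set_countable, Cardinal.mk_Iio_ordinal, Cardinal.lift_le_aleph0]
  rw [omega1, Cardinal.lt_ord, ← Cardinal.succ_aleph0, Order.lt_succ_iff] at ha
  exact ha

theorem exists_tower : ∃ X V : Ordinal → Set ℕ, ∀ a < omega1,
    (X a).Infinite ∧ (V a).Infinite ∧ Disjoint (X a) (V a) ∧
    (∀ b < a, ((X a ∪ V a) \ V b).Finite) ∧
    (∀ k, ∑' b : Set.Iio a, q k (X b ∩ X a) ≠ ⊤) ∧
    (∀ k, ∑' b : Set.Iio a, q k (X b ∩ V a) ≠ ⊤) := by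
  obtain ⟨f, hf⟩ := rec_exists (Y := Set ℕ × Set ℕ) omega1
    (fun a f y => y.1.Infinite ∧ y.2.Infinite ∧ Disjoint y.1 y.2 ∧
      (∀ b, ((y.1 ∪ y.2) \ (f b).2).Finite) ∧
      (∀ k, ∑' b, q k ((f b).1 ∩ y.1) ≠ ⊤) ∧
      (∀ k, ∑' b, q k ((f b).1 ∩ y.2) ≠ ⊤)) (by
    intro a ha f hf
    have := (countable_Iio ha).to_subtype
    obtain ⟨Y, W, h⟩ := step (I := Set.Iio a) (fun x => (f x).1) (fun x => (f x).2)
      (fun i => (hf i i.2).1) (fun i => (hf i i.2).2.1)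
      (fun i j hij => (hf j j.2).2.2.2.1 ⟨i, hij⟩) (fun i => (hf i i.2).2.2.1)
      (by
        intro i k
        have h1 := (hf i i.2).2.2.2.2.2 k
        refine ne_top_of_le_ne_top h1 ?_
        let φ : Set.Iio i → Set.Iio (i : Ordinal) := fun j => ⟨j.1.1, j.2⟩
        have hφ : Function.Injective φ := by
          intro x y hxy
          apply Subtype.ext
          apply Subtype.ext
          exact congrArg (fun z : Set.Iio (i : Ordinal) => (z : Ordinal)) hxy
        exact ENNReal.tsum_comp_le_tsum_of_injective hφ
          (fun b : Set.Iio (i : Ordinal) => q k ((f b).1 ∩ (f i).2)))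
    exact ⟨(Y, W), h⟩)
  exact ⟨fun a => (f a).1, fun a => (f a).2, fun a ha => by
    obtain ⟨h1, h2, h3, h4, h5, h6⟩ := hf a ha
    exact ⟨h1, h2, h3, fun b hb => h4 ⟨b, hb⟩, h5, h6⟩⟩

/-- Countable coherent families can be amalgamated. -/
theorem amalgamate {I : Type*} [Countable I] (S C : I → Set ℕ) (hCS : ∀ i, C i ⊆ S i)
    (hco : ∀ i j, ((C i ∩ S j) \ C j).Finite) :
    ∃ A : Set ℕ, ∀ i, ((A ∩ S i) \ C i).Finite ∧ (C i \ A).Finite := by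
  classical
  obtain ⟨e, he⟩ := Countable.exists_injective_nat I
  have hfin : ∀ j, {i | e i ≤ j}.Finite := fun j => (Set.finite_Iic j).preimage he.injOn
  refine ⟨{x | ∃ i, x ∈ C i ∧ ∀ j, e j < e i → x ∉ S j}, fun i => ⟨?_, ?_⟩⟩
  · refine ((hfin (e i)).biUnion (t := fun j => (C j ∩ S i) \ C i) (fun j _ => hco j i)).subset ?_
    rintro x ⟨⟨⟨j, hj, hmin⟩, hxS⟩, hxC⟩
    refine Set.mem_biUnion (x := j) ?_ ⟨⟨hj, hxS⟩, hxC⟩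
    by_contra hcon
    exact hmin i (not_le.1 hcon) hxS
  · refine ((hfin (e i)).biUnion (t := fun j => (C i ∩ S j) \ C j) (fun j _ => hco i j)).subset ?_
    rintro x ⟨hxC, hxA⟩
    have hex : ∃ n, ∃ j, e j = n ∧ x ∈ S j := ⟨_, i, rfl, hCS i hxC⟩
    obtain ⟨j, hj, hxj⟩ := Nat.find_spec hex
    refine Set.mem_biUnion (x := j) ?_ ⟨⟨hxC, hxj⟩, fun hxCj => hxA ⟨j, hxCj, ?_⟩⟩
    · change e j ≤ e i
      rw [hj]
      exact Nat.find_min' hex ⟨i, rfl, hCS i hxC⟩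
    · intro j' hj' hx'
      rw [hj] at hj'
      exact Nat.find_min hex hj' ⟨j', rfl, hx'⟩

theorem exists_gap_refinement (X V : Ordinal → Set ℕ)
    (hdisj : ∀ a < omega1, Disjoint (X a) (V a))
    (hlt : ∀ a < omega1, ∀ b < a, ((X a ∪ V a) \ V b).Finite) (𝒳 : Set Ordinal) :
    ∃ C : Ordinal → Set ℕ, ∀ a < omega1, C a ⊆ (V a)ᶜ ∧ (a ∈ 𝒳 → X a ⊆ C a) ∧
      (a ∉ 𝒳 → Disjoint (X a) (C a)) ∧
      ∀ b < a, ((C a \ V b) \ C b).Finite ∧ (C b \ C a).Finite := by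
  classical
  obtain ⟨C, hC⟩ := rec_exists (Y := Set ℕ) omega1
    (fun a f y => y ⊆ (V a)ᶜ ∧ (a ∈ 𝒳 → X a ⊆ y) ∧ (a ∉ 𝒳 → Disjoint (X a) y) ∧
      ∀ b : Set.Iio a, ((y \ V b) \ f b).Finite ∧ (f b \ y).Finite) (by
    intro a ha f hf
    have := (countable_Iio ha).to_subtype
    obtain ⟨A, hA⟩ := amalgamate (I := Set.Iio a) (fun b => (V b)ᶜ) (fun b => f b)
      (fun b => (hf b b.2).1) (by
        intro i j
        rcases lt_trichotomy (i : Ordinal) j with h | h | h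
        · exact ((hf j j.2).2.2.2 ⟨i, h⟩).2.subset (fun x hx => ⟨hx.1.1, hx.2⟩)
        · have : i = j := Subtype.ext h
          subst this
          refine Set.finite_empty.subset ?_
          rintro x ⟨⟨h1, h2⟩, h3⟩
          exact h3 h1
        · exact ((hf i i.2).2.2.2 ⟨j, h⟩).1)
    refine ⟨(A \ (X a ∪ V a)) ∪ (if a ∈ 𝒳 then X a else ∅), ?_, ?_, ?_, ?_⟩
    · rintro x (hx | hx)
      · exact fun h => hx.2 (Or.inr h)
      · split_ifs at hx
        · exact Set.disjoint_left.1 (hdisj a ha) hx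
        · exact hx.elim
    · intro h
      rw [if_pos h]
      exact Set.subset_union_right
    · intro h
      rw [if_neg h, Set.union_empty]
      exact Set.disjoint_left.2 (fun x hx hx' => hx'.2 (Or.inl hx))
    · intro b
      have hb := hlt a ha b b.2
      refine ⟨((hA b).1.union hb).subset ?_, ((hA b).2.union hb).subset ?_⟩
      · rintro x ⟨⟨hx | hx, hxV⟩, hxf⟩
        · exact Or.inl ⟨⟨hx.1, hxV⟩, hxf⟩
        · right
          split_ifs at hx
          · exact ⟨Or.inl hx, hxV⟩
          · exact hx.elim
      · rintro x ⟨hxf, hx⟩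
        by_cases hxA : x ∈ A
        · right
          refine ⟨?_, (hf b b.2).1 hxf⟩
          by_contra hcon
          exact hx (Or.inl ⟨hxA, hcon⟩)
        · exact Or.inl ⟨hxf, hxA⟩)
  exact ⟨C, fun a ha => by
    obtain ⟨h1, h2, h3, h4⟩ := hC a ha
    exact ⟨h1, h2, h3, fun b hb => h4 ⟨b, hb⟩⟩⟩

theorem inseparable (X : Ordinal → Set ℕ)
    (hsum : ∀ a < omega1, ∑' b : Set.Iio a, q 0 (X b ∩ X a) ≠ ⊤)
    (had : ∀ a < omega1, ∀ b < a, (X b ∩ X a).Finite)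
    (S T : Set Ordinal) (hS : S ⊆ Set.Iio omega1) (hT : T ⊆ Set.Iio omega1)
    (hSc : ¬ S.Countable) (hTc : ¬ T.Countable) : ¬ SeparatedFamilies (X '' S) (X '' T) := by
  rintro ⟨C, hC1, hC2⟩
  have pig : ∀ (R : Set Ordinal) (Z : Ordinal → Set ℕ), ¬ R.Countable → (∀ b ∈ R, (Z b).Finite) →
      ∃ n, ¬ {b ∈ R | Z b ⊆ Set.Iio n}.Countable := by
    intro R Z hR hZ
    by_contra! hcon
    apply hR
    refine (Set.countable_iUnion hcon).mono ?_
    intro b hb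
    obtain ⟨n, hn⟩ := (hZ b hb).bddAbove
    exact Set.mem_iUnion.2 ⟨n + 1, hb, fun x hx => Nat.lt_succ_of_le (hn hx)⟩
  obtain ⟨n, hn⟩ := pig S (fun b => X b \ C) hSc (fun b hb => hC1 _ ⟨b, hb, rfl⟩)
  obtain ⟨m, hm⟩ := pig T (fun b => X b ∩ C) hTc (fun b hb => hC2 _ ⟨b, hb, rfl⟩)
  have hinf : {b ∈ S | X b \ C ⊆ Set.Iio n}.Infinite := fun h => hn h.countable
  obtain ⟨φ, hφ⟩ : ∃ φ : ℕ → Ordinal, Function.Injective φ ∧ ∀ i, φ i ∈ {b ∈ S | X b \ C ⊆ Set.Iio n} :=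
    ⟨fun i => hinf.natEmbedding _ i, fun x y h => (hinf.natEmbedding _).injective (Subtype.ext h),
      fun i => (hinf.natEmbedding _ i).2⟩
  obtain ⟨g, hgT, hg⟩ : ∃ g ∈ {b ∈ T | X b ∩ C ⊆ Set.Iio m}, ∀ i, φ i < g := by
    by_contra! hcon
    apply hm
    have : (⋃ i, (insert (φ i) (Set.Iio (φ i)))).Countable :=
      Set.countable_iUnion fun i => (countable_Iio (hS (hφ.2 i).1)).insert _
    refine this.mono ?_
    intro g hg
    obtain ⟨i, hi⟩ := hcon g hg
    refine Set.mem_iUnion.2 ⟨i, ?_⟩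
    rcases hi.eq_or_lt with h | h
    · exact Or.inl h
    · exact Or.inr h
  have hgo : g < omega1 := hT hgT.1
  apply hsum g hgo
  have h1 : ∑' i : ℕ, cc 0 ^ (max n m) = ⊤ :=
    ENNReal.tsum_const_eq_top_of_ne_zero (pow_ne_zero _ (cc_ne_zero 0))
  rw [eq_top_iff, ← h1]
  let ψ : ℕ → Set.Iio g := fun i => ⟨φ i, hg i⟩
  have hψ : Function.Injective ψ := fun x y h => hφ.1 (congrArg Subtype.val h)
  refine le_trans ?_ (ENNReal.tsum_comp_le_tsum_of_injective hψ
    (fun b : Set.Iio g => q 0 (X b ∩ X g)))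
  refine ENNReal.tsum_le_tsum fun i => ?_
  change _ ≤ q 0 (X (φ i) ∩ X g)
  rw [q_fin (had g hgo _ (hg i))]
  apply pow_le_pow_right_of_le_one' (cc_lt_one 0).le
  have hsub : X (φ i) ∩ X g ⊆ Set.Iio (max n m) := by
    rintro x ⟨hx1, hx2⟩
    by_cases hxC : x ∈ C
    · exact lt_of_lt_of_le (Set.mem_Iio.1 (hgT.2 ⟨hx2, hxC⟩)) (le_max_right _ _)
    · exact lt_of_lt_of_le (Set.mem_Iio.1 ((hφ.2 i).2 ⟨hx1, hxC⟩)) (le_max_left _ _)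
  refine (Set.ncard_le_ncard hsub (Set.finite_Iio _)).trans (le_of_eq ?_)
  rw [Set.ncard_eq_toFinset_card']
  simp

end LuzinGap

theorem exists_luzin_family_refining_gaps :
    ∃ X : Ordinal → Set ℕ,
      (∀ α : Ordinal, α < omega1 → (X α).Infinite) ∧
      (∀ α β : Ordinal, α < omega1 → β < omega1 → α ≠ β →
        X α ≠ X β ∧ (X α ∩ X β).Finite) ∧
      (∀ S T : Set Ordinal, S ⊆ Set.Iio omega1 → T ⊆ Set.Iio omega1 → Disjoint S T →
        ¬ S.Countable → ¬ T.Countable → ¬ SeparatedFamilies (X '' S) (X '' T)) ∧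
      (∀ 𝒳 : Set Ordinal, 𝒳 ⊆ Set.Iio omega1 →
        ¬ 𝒳.Countable → ¬ (Set.Iio omega1 \ 𝒳).Countable →
        ∃ A B : Ordinal → Set ℕ,
          (∀ α : Ordinal, α < omega1 → A α ∩ B α = ∅) ∧
          (∀ α β : Ordinal, α < β → β < omega1 →
            (A α \ A β).Finite ∧ (B α \ B β).Finite) ∧
          (∀ β α : Ordinal, β < α → α < omega1 →
            (β ∈ 𝒳 → (X β \ A α).Finite) ∧ (β ∉ 𝒳 → (X β \ B α).Finite)) ∧
          ¬ ∃ C : Set ℕ, ∀ α : Ordinal, α < omega1 →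
            (A α \ C).Finite ∧ (C ∩ B α).Finite) := by
  obtain ⟨X, V, h⟩ := LuzinGap.exists_tower
  have hdisj : ∀ a < omega1, Disjoint (X a) (V a) := fun a ha => (h a ha).2.2.1
  have hlt : ∀ a < omega1, ∀ b < a, ((X a ∪ V a) \ V b).Finite := fun a ha => (h a ha).2.2.2.1
  have hXU : ∀ a < omega1, ∀ b < a, (X b ∩ (X a ∪ V a)).Finite := by
    intro a ha b hb
    refine (hlt a ha b hb).subset ?_
    rintro x ⟨hx, hx'⟩
    exact ⟨hx', Set.disjoint_left.1 (hdisj b (hb.trans ha)) hx⟩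
  have had : ∀ a < omega1, ∀ b < a, (X b ∩ X a).Finite := fun a ha b hb =>
    (hXU a ha b hb).subset (fun x hx => ⟨hx.1, Or.inl hx.2⟩)
  have hins : ∀ S T : Set Ordinal, S ⊆ Set.Iio omega1 → T ⊆ Set.Iio omega1 →
      ¬ S.Countable → ¬ T.Countable → ¬ SeparatedFamilies (X '' S) (X '' T) :=
    LuzinGap.inseparable X (fun a ha => (h a ha).2.2.2.2.1 0) had
  refine ⟨X, fun a ha => (h a ha).1, ?_, fun S T hS hT _ hSc hTc => hins S T hS hT hSc hTc, ?_⟩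
  · intro a b ha hb hab
    have hfin : (X a ∩ X b).Finite := by
      rcases lt_or_gt_of_ne hab with h' | h'
      · exact had b hb a h'
      · rw [Set.inter_comm]; exact had a ha b h'
    refine ⟨fun heq => ?_, hfin⟩
    rw [heq, Set.inter_self] at hfin
    exact (h b hb).1 hfin
  · intro 𝒳 h𝒳 hc1 hc2
    obtain ⟨C, hC⟩ := LuzinGap.exists_gap_refinement X V hdisj hlt 𝒳
    have hlim : ∀ a < omega1, Order.succ a < omega1 := by
      intro a ha
      exact (Cardinal.isSuccLimit_ord (Cardinal.aleph0_le_aleph 1)).succ_lt ha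
    have hc : ∀ β α : Ordinal, β < α → α < omega1 →
        (β ∈ 𝒳 → (X β \ (C α \ (X α ∪ V α))).Finite) ∧
        (β ∉ 𝒳 → (X β \ ((X α ∪ V α)ᶜ \ C α)).Finite) := by
      intro b a hb ha
      obtain ⟨h1, h2, h3, h4⟩ := hC a ha
      obtain ⟨g1, g2, g3, g4⟩ := hC b (hb.trans ha)
      refine ⟨fun hm => ((h4 b hb).2.union (hXU a ha b hb)).subset ?_,
        fun hm => ((h4 b hb).1.union (hXU a ha b hb)).subset ?_⟩
      · rintro x ⟨hx, hx'⟩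
        by_cases hxC : x ∈ C a
        · right
          refine ⟨hx, ?_⟩
          by_contra hcon
          exact hx' ⟨hxC, hcon⟩
        · exact Or.inl ⟨g2 hm hx, hxC⟩
      · rintro x ⟨hx, hx'⟩
        by_cases hxU : x ∈ X a ∪ V a
        · exact Or.inr ⟨hx, hxU⟩
        · left
          refine ⟨⟨?_, Set.disjoint_left.1 (hdisj b (hb.trans ha)) hx⟩,
            Set.disjoint_left.1 (g3 hm) hx⟩
          by_contra hcon
          exact hx' ⟨hxU, hcon⟩
    refine ⟨fun a => C a \ (X a ∪ V a), fun a => (X a ∪ V a)ᶜ \ C a, ?_, ?_, hc, ?_⟩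
    · intro a ha
      ext x
      simp only [Set.mem_inter_iff, Set.mem_sdiff, Set.mem_empty_iff_false, iff_false]
      tauto
    · intro b a hb ha
      obtain ⟨h1, h2, h3, h4⟩ := hC a ha
      have hu := hlt a ha b hb
      refine ⟨((h4 b hb).2.union hu).subset ?_, ((h4 b hb).1.union hu).subset ?_⟩
      · rintro x ⟨⟨hx, hxU⟩, hx'⟩
        by_cases hxC : x ∈ C a
        · right
          refine ⟨?_, fun hv => hxU (Or.inr hv)⟩
          by_contra hcon
          exact hx' ⟨hxC, hcon⟩
        · exact Or.inl ⟨hx, hxC⟩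
      · rintro x ⟨⟨hxU, hxC⟩, hx'⟩
        have hv : x ∉ V b := fun hv => hxU (Or.inr hv)
        by_cases hxa : x ∈ X a ∪ V a
        · exact Or.inr ⟨hxa, hv⟩
        · left
          refine ⟨⟨?_, hv⟩, hxC⟩
          by_contra hcon
          exact hx' ⟨hxa, hcon⟩
    · rintro ⟨E, hE⟩
      refine hins 𝒳 (Set.Iio omega1 \ 𝒳) h𝒳 Set.sdiff_subset hc1 hc2 ⟨E, ?_, ?_⟩
      · rintro _ ⟨b, hb, rfl⟩
        have hb' := hlim b (h𝒳 hb)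
        refine (((hc b _ (Order.lt_succ b) hb').1 hb).union (hE _ hb').1).subset ?_
        rintro x ⟨hx, hxE⟩
        by_cases hxA : x ∈ C (Order.succ b) \ (X (Order.succ b) ∪ V (Order.succ b))
        · exact Or.inr ⟨hxA, hxE⟩
        · exact Or.inl ⟨hx, hxA⟩
      · rintro _ ⟨b, ⟨hb, hbn⟩, rfl⟩
        have hb' := hlim b hb
        refine (((hc b _ (Order.lt_succ b) hb').2 hbn).union (hE _ hb').2).subset ?_
        rintro x ⟨hx, hxE⟩
        by_cases hxB : x ∈ (X (Order.succ b) ∪ V (Order.succ b))ᶜ \ C (Order.succ b)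
        · exact Or.inr ⟨hxE, hxB⟩
        · exact Or.inl ⟨hx, hxB⟩
end
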